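/- arXiv:1609.00069 — 4 statements merged into one kernel-verified Lean document; each statement's English description precedes it below -/
import Mathlib

section
/- Let F be a forest consisting of k vertex-disjoint stars with numbers of edges a_1 ≤ a_2 ≤ … ≤ a_k, and suppose F contains a star with exactly one edge (a_1 = 1). Then for all sufficiently large n, ex*(n, F) = max{ (a_1 + a_2 + … + a_k − 1)·⌊n/2⌋ , C(k−1, 2) + (k−1)(n−k+1) }. -/
open SimpleGraph Finset

/-- `c` is a proper edge-coloring of `G`: distinct edges sharing a vertex get distinct colors. -/
def IsProperEdgeColoring {V β : Type*} (G : SimpleGraph V) (c : Sym2 V → β) : Prop :=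
  ∀ ⦃e₁ e₂ : Sym2 V⦄, e₁ ∈ G.edgeSet → e₂ ∈ G.edgeSet → e₁ ≠ e₂ →
    (∃ v, v ∈ e₁ ∧ v ∈ e₂) → c e₁ ≠ c e₂

/-- `G` contains a copy of `F` (as a subgraph). -/
def Contains {α V : Type*} (F : SimpleGraph α) (G : SimpleGraph V) : Prop :=
  ∃ f : α ↪ V, ∀ ⦃a b⦄, F.Adj a b → G.Adj (f a) (f b)

/-- `G`, edge-colored by `c`, contains a rainbow copy of `F`:
a copy of `F` all of whose edges receive distinct colors. -/
def HasRainbowCopy {α V β : Type*} (F : SimpleGraph α) (G : SimpleGraph V)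
    (c : Sym2 V → β) : Prop :=
  ∃ f : α ↪ V, (∀ ⦃a b⦄, F.Adj a b → G.Adj (f a) (f b)) ∧
    ∀ e₁ ∈ F.edgeSet, ∀ e₂ ∈ F.edgeSet, c (e₁.map ⇑f) = c (e₂.map ⇑f) → e₁ = e₂

/-- The set of edge-counts of `n`-vertex graphs admitting a proper edge-coloring
with no rainbow copy of `F`; its greatest element is the rainbow Turán number `ex*(n,F)`. -/
def rainbowExSet (n : ℕ) {α : Type*} (F : SimpleGraph α) : Set ℕ :=
  {m | ∃ (G : SimpleGraph (Fin n)) (c : Sym2 (Fin n) → ℕ),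
    IsProperEdgeColoring G c ∧ ¬ HasRainbowCopy F G c ∧ G.edgeSet.ncard = m}

/-- The set of edge-counts of `n`-vertex `F`-free graphs; its greatest element
is the Turán number `ex(n,F)`. -/
def exSet (n : ℕ) {α : Type*} (F : SimpleGraph α) : Set ℕ :=
  {m | ∃ G : SimpleGraph (Fin n), ¬ Contains F G ∧ G.edgeSet.ncard = m}

/-- The matching `M_k` with `k` edges: vertices `2i` and `2i+1` are matched. -/
def matchingGraph (k : ℕ) : SimpleGraph (Fin (2 * k)) :=
  SimpleGraph.fromRel (fun a b => (a : ℕ) / 2 = (b : ℕ) / 2)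

/-- The forest of `k` vertex-disjoint stars where the `i`-th star has `a i` edges
(the vertex `⟨i, 0⟩` being the center of the `i`-th star). -/
def starForest {k : ℕ} (a : Fin k → ℕ) : SimpleGraph (Σ i, Fin (a i + 1)) :=
  SimpleGraph.fromRel (fun x y => x.1 = y.1 ∧ (x.2 : ℕ) = 0)


structure Sel {ι V : Type*} (S : ι → Finset V) (col : ι → V → ℕ) (a : ι → ℕ)
    (I : Finset ι) (L : ι → Finset V) : Prop where
  sub : ∀ i ∈ I, L i ⊆ S i
  card : ∀ i ∈ I, (L i).card = a i
  disj : ∀ i ∈ I, ∀ j ∈ I, ∀ x, x ∈ L i → x ∈ L j → i = j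
  rb : ∀ i ∈ I, ∀ j ∈ I, ∀ x ∈ L i, ∀ y ∈ L j, col i x = col j y → i = j

def usedCol {ι V : Type*} (col : ι → V → ℕ) (I : Finset ι) (L : ι → Finset V) : Finset ℕ :=
  I.biUnion fun j => (L j).image (col j)

lemma Sel.used_card_le {ι V : Type*} {S : ι → Finset V} {col : ι → V → ℕ} {a : ι → ℕ}
    {I : Finset ι} {L : ι → Finset V} (h : Sel S col a I L) :
    (usedCol col I L).card ≤ ∑ i ∈ I, a i := by
  unfold usedCol
  refine Finset.card_biUnion_le.trans (Finset.sum_le_sum fun i hi => ?_)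
  exact Finset.card_image_le.trans (h.card i hi).le

lemma Sel.step {ι V : Type*} [DecidableEq ι] {S : ι → Finset V} {col : ι → V → ℕ} {a : ι → ℕ}
    {I : Finset ι} {L : ι → Finset V} (h : Sel S col a I L) (i : ι) (hi : i ∉ I)
    (T : Finset V) (hTS : T ⊆ S i) (hinj : Set.InjOn (col i) T)
    (hT : ∀ j ∈ I, ∀ x ∈ T, x ∉ L j) (U : Finset ℕ)
    (hU : ∀ x ∈ T, col i x ∈ usedCol col I L → col i x ∈ U)
    (hc : a i + U.card ≤ T.card) :
    ∃ L', Sel S col a (insert i I) L' ∧ ∀ j ∈ I, L' j = L j := by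
  classical
  have h1 : (T.filter (fun x => col i x ∈ U)).card ≤ U.card := by
    refine Finset.card_le_card_of_injOn (col i) (fun x hx => ?_) (hinj.mono ?_)
    · simp at hx; exact hx.2
    · intro x hx; simp at hx; exact hx.1
  have h2 := Finset.card_filter_add_card_filter_not (s := T) (fun x => col i x ∈ U)
  obtain ⟨R, hR, hRc⟩ := Finset.exists_subset_card_eq
    (s := T.filter (fun x => ¬ col i x ∈ U)) (n := a i) (by omega)
  have hRT : R ⊆ T := hR.trans (Finset.filter_subset _ _)
  have hRU : ∀ x ∈ R, col i x ∉ usedCol col I L := fun x hx hx' =>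
    (Finset.mem_filter.1 (hR hx)).2 (hU x (hRT hx) hx')
  have hne : ∀ j ∈ I, j ≠ i := fun j hj e => hi (e ▸ hj)
  have hL : ∀ j ∈ I, Function.update L i R j = L j := fun j hj =>
    Function.update_of_ne (hne j hj) _ _
  have hLi : Function.update L i R i = R := Function.update_self _ _ _
  have hmemU : ∀ j ∈ I, ∀ y ∈ L j, col j y ∈ usedCol col I L := fun j hj y hy =>
    Finset.mem_biUnion.2 ⟨j, hj, Finset.mem_image_of_mem _ hy⟩
  refine ⟨Function.update L i R, ⟨?_, ?_, ?_, ?_⟩, hL⟩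
  · intro j hj
    rcases Finset.mem_insert.1 hj with rfl | hj
    · rw [hLi]; exact hRT.trans hTS
    · rw [hL j hj]; exact h.sub j hj
  · intro j hj
    rcases Finset.mem_insert.1 hj with rfl | hj
    · rw [hLi]; exact hRc
    · rw [hL j hj]; exact h.card j hj
  · intro j hj j' hj' x hx hx'
    rcases Finset.mem_insert.1 hj with hji | hjI <;> rcases Finset.mem_insert.1 hj' with hji' | hjI'
    · exact hji.trans hji'.symm
    · subst hji; rw [hLi] at hx; rw [hL _ hjI'] at hx'
      exact absurd hx' (hT _ hjI' _ (hRT hx))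
    · subst hji'; rw [hLi] at hx'; rw [hL _ hjI] at hx
      exact absurd hx (hT _ hjI _ (hRT hx'))
    · rw [hL _ hjI] at hx; rw [hL _ hjI'] at hx'
      exact h.disj _ hjI _ hjI' x hx hx'
  · intro j hj j' hj' x hx y hx' hxy
    rcases Finset.mem_insert.1 hj with hji | hjI <;> rcases Finset.mem_insert.1 hj' with hji' | hjI'
    · exact hji.trans hji'.symm
    · subst hji; rw [hLi] at hx; rw [hL _ hjI'] at hx'
      exact absurd (hxy ▸ hmemU _ hjI' _ hx') (hRU _ hx)
    · subst hji'; rw [hLi] at hx'; rw [hL _ hjI] at hx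
      exact absurd (hxy ▸ hmemU _ hjI _ hx) (hRU _ hx')
    · rw [hL _ hjI] at hx; rw [hL _ hjI'] at hx'
      exact h.rb _ hjI _ hjI' x hx y hx' hxy

lemma Sel.extend {ι V : Type*} [DecidableEq ι] {S : ι → Finset V} {col : ι → V → ℕ} {a : ι → ℕ}
    {I : Finset ι} {L : ι → Finset V} (h : Sel S col a I L) (B : ℕ) (J : Finset ι)
    (hinj : ∀ i, Set.InjOn (col i) (S i))
    (hB : ∑ i ∈ I ∪ J, a i ≤ B)
    (hJ : ∀ i ∈ J, i ∉ I →
      (B ≤ (S i).card ∧ ∀ j ∈ I ∪ J, j ≠ i → Disjoint (S i) (S j)) ∨ 2 * B ≤ (S i).card) :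
    ∃ L', Sel S col a (I ∪ J) L' ∧ ∀ j ∈ I, L' j = L j := by
  classical
  induction J using Finset.induction_on with
  | empty => exact ⟨L, by simpa using h, fun _ _ => rfl⟩
  | insert i J hi ih =>
    have hsub : I ∪ J ⊆ I ∪ insert i J :=
      Finset.union_subset_union_right (Finset.subset_insert _ _)
    obtain ⟨L₁, hL₁, hL₁'⟩ := ih ((Finset.sum_le_sum_of_subset hsub).trans hB)
      (fun i' hi' hi'' => (hJ i' (Finset.mem_insert_of_mem hi') hi'').imp
        (fun hh => ⟨hh.1, fun j hj hne => hh.2 j (hsub hj) hne⟩) id)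
    by_cases hiI : i ∈ I
    · refine ⟨L₁, ?_, hL₁'⟩
      have : I ∪ insert i J = I ∪ J := by
        ext x; simp only [Finset.mem_union, Finset.mem_insert]
        constructor
        · rintro (h | rfl | h) <;> simp_all
        · tauto
      rwa [this]
    have hins : I ∪ insert i J = insert i (I ∪ J) := by
      rw [Finset.union_insert]
    have hnot : i ∉ I ∪ J := by simp [hiI, hi]
    rw [hins, Finset.sum_insert hnot] at hB
    have hu := hL₁.used_card_le
    have key : ∃ T ⊆ S i, (∀ j ∈ I ∪ J, ∀ x ∈ T, x ∉ L₁ j) ∧ B ≤ T.card := by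
      rcases hJ i (Finset.mem_insert_self _ _) hiI with ⟨h1, h2⟩ | h1
      · refine ⟨S i, Finset.Subset.refl _, fun j hj x hx hx' => ?_, h1⟩
        exact Finset.disjoint_left.1 (h2 j (hsub hj) (fun e => hnot (e ▸ hj))) hx
          (hL₁.sub j hj hx')
      · refine ⟨S i \ (I ∪ J).biUnion L₁, Finset.sdiff_subset, fun j hj x hx hx' => ?_, ?_⟩
        · exact (Finset.mem_sdiff.1 hx).2 (Finset.mem_biUnion.2 ⟨j, hj, hx'⟩)
        · have e1 : ((I ∪ J).biUnion L₁).card ≤ ∑ j ∈ I ∪ J, a j :=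
            Finset.card_biUnion_le.trans (Finset.sum_le_sum fun j hj => (hL₁.card j hj).le)
          have e2 := Finset.le_card_sdiff ((I ∪ J).biUnion L₁) (S i)
          omega
    obtain ⟨T, hTS, hT, hTB⟩ := key
    obtain ⟨L', hL', hL''⟩ := hL₁.step i hnot T hTS ((hinj i).mono (by exact_mod_cast hTS)) hT
      (usedCol col (I ∪ J) L₁) (fun _ _ h => h) (by omega)
    refine ⟨L', by rw [hins]; exact hL', fun j hj => ?_⟩
    rw [hL'' j (Finset.mem_union_left _ hj), hL₁' j hj]

lemma rainbow_of_sel {V : Type*} (G : SimpleGraph V) (c : Sym2 V → ℕ)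
    (hc : IsProperEdgeColoring G c) {k : ℕ} (a : Fin k → ℕ)
    (v : Fin k → V) (hv : Function.Injective v) (S L : Fin k → Finset V)
    (hS : ∀ i, ∀ x ∈ S i, G.Adj (v i) x ∧ ∀ j, x ≠ v j)
    (hL : Sel S (fun i x => c s(v i, x)) a Finset.univ L) :
    HasRainbowCopy (starForest a) G c := by
  classical
  have hm : ∀ i, ∃ g : Fin (a i) → V, Function.Injective g ∧ ∀ t, g t ∈ L i := by
    intro i
    have hcard := hL.card i (Finset.mem_univ _)
    refine ⟨fun t => ((L i).equivFin.symm (Fin.cast hcard.symm t)).1, ?_, fun t => ?_⟩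
    · intro t t' h
      have := (L i).equivFin.symm.injective (Subtype.ext h)
      exact Fin.cast_injective _ this
    · exact ((L i).equivFin.symm (Fin.cast hcard.symm t)).2
  choose g hginj hg using hm
  have hgS : ∀ i t, g i t ∈ S i := fun i t => hL.sub i (Finset.mem_univ _) (hg i t)
  let f : (Σ i, Fin (a i + 1)) → V := fun x => Fin.cases (v x.1) (g x.1) x.2
  have f0 : ∀ i, f ⟨i, 0⟩ = v i := fun i => rfl
  have fs : ∀ i t, f ⟨i, Fin.succ t⟩ = g i t := fun i t => rfl
  have hf : Function.Injective f := by
    rintro ⟨i, t⟩ ⟨j, u⟩ h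
    induction t using Fin.cases with
    | zero =>
      induction u using Fin.cases with
      | zero => rw [f0, f0] at h; rw [hv h]
      | succ u => rw [f0, fs] at h; exact absurd h.symm ((hS j _ (hgS j u)).2 i)
    | succ t =>
      induction u using Fin.cases with
      | zero => rw [f0, fs] at h; exact absurd h ((hS i _ (hgS i t)).2 j)
      | succ u =>
        rw [fs, fs] at h
        obtain rfl := hL.disj i (Finset.mem_univ _) j (Finset.mem_univ _) _ (hg i t) (h ▸ hg j u)
        rw [hginj i h]
  have hedge : ∀ x y, (starForest a).Adj x y →
      ∃ i, ∃ t : Fin (a i), s(x, y) = s(⟨i, 0⟩, ⟨i, Fin.succ t⟩) := by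
    have aux : ∀ x y : (Σ i, Fin (a i + 1)), x ≠ y → x.1 = y.1 → (x.2 : ℕ) = 0 →
        ∃ i, ∃ t : Fin (a i), s(x, y) = s(⟨i, 0⟩, ⟨i, Fin.succ t⟩) := by
      rintro ⟨i, t⟩ ⟨j, u⟩ hne h h0
      simp only at h h0
      subst h
      have : t = 0 := Fin.ext h0
      subst this
      induction u using Fin.cases with
      | zero => exact absurd rfl hne
      | succ u => exact ⟨i, u, rfl⟩
    intro x y h
    rw [starForest, SimpleGraph.fromRel_adj] at h
    rcases h with ⟨hne, h | h⟩
    · exact aux x y hne h.1 h.2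
    · obtain ⟨i, t, e⟩ := aux y x hne.symm h.1 h.2
      exact ⟨i, t, by rw [Sym2.eq_swap, e]⟩
  have hgadj : ∀ i t, G.Adj (v i) (g i t) := fun i t => (hS i _ (hgS i t)).1
  refine ⟨⟨f, hf⟩, ?_, ?_⟩
  · intro x y h
    obtain ⟨i, t, e⟩ := hedge x y h
    have e' := congrArg (Sym2.map f) e
    rw [Sym2.map_mk, Sym2.map_mk] at e'
    change G.Adj (f x) (f y)
    rw [← SimpleGraph.mem_edgeSet, show s(f x, f y) = s(v i, g i t) from e']
    exact hgadj i t
  · intro e₁ h₁ e₂ h₂ h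
    induction e₁ using Sym2.ind with | _ x y
    induction e₂ using Sym2.ind with | _ x' y'
    obtain ⟨i, t, e⟩ := hedge x y h₁
    obtain ⟨j, u, e'⟩ := hedge x' y' h₂
    rw [e, e'] at h ⊢
    change c s(v i, g i t) = c s(v j, g j u) at h
    obtain rfl := hL.rb i (Finset.mem_univ _) j (Finset.mem_univ _) _ (hg i t) _ (hg j u) h
    by_cases htu : t = u
    · rw [htu]
    · refine absurd h (hc (hgadj i t) (hgadj i u) ?_ ⟨v i, by simp, by simp⟩)
      intro hh
      rw [Sym2.congr_right] at hh
      exact htu (hginj i hh)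

lemma col_injOn {V : Type*} {G : SimpleGraph V} {c : Sym2 V → ℕ}
    (hc : IsProperEdgeColoring G c) (v : V) (T : Finset V) (hT : ∀ x ∈ T, G.Adj v x) :
    Set.InjOn (fun x => c s(v, x)) T := by
  intro x hx y hy h
  by_contra hne
  refine hc (hT x hx) (hT y hy) ?_ ⟨v, by simp, by simp⟩ h
  intro hh
  rw [Sym2.congr_right] at hh
  exact hne hh

open scoped Classical in
/-- extension of a selection on the lower indices by high-degree vertices -/
lemma rainbow_of_low {V : Type*} [Fintype V] (G : SimpleGraph V) (c : Sym2 V → ℕ)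
    (hc : IsProperEdgeColoring G c) {k : ℕ} (a : Fin k → ℕ) (H : Finset V) (m : ℕ)
    (hm : H.card + m = k) (hH : ∀ x ∈ H, 2 * ∑ i, a i + k ≤ G.degree x)
    (w : Fin k → V) (S L : Fin k → Finset V)
    (hwH : ∀ i : Fin k, (i : ℕ) < m → w i ∉ H)
    (hwinj : ∀ i j : Fin k, (i : ℕ) < m → (j : ℕ) < m → w i = w j → i = j)
    (hS : ∀ i : Fin k, (i : ℕ) < m → ∀ x ∈ S i, G.Adj (w i) x ∧ x ∉ H ∧
      ∀ j : Fin k, (j : ℕ) < m → x ≠ w j)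
    (hL : Sel S (fun i x => c s(w i, x)) a (Finset.univ.filter fun i : Fin k => (i : ℕ) < m) L) :
    HasRainbowCopy (starForest a) G c := by
  set I : Finset (Fin k) := Finset.univ.filter fun i : Fin k => (i : ℕ) < m with hI
  have hmI : ∀ i, i ∈ I ↔ (i : ℕ) < m := by intro i; simp [hI]
  let v : Fin k → V := fun i => if h : (i : ℕ) < m then w i else
    (H.equivFin.symm ⟨(i : ℕ) - m, by have := i.2; omega⟩).1
  have v1 : ∀ i : Fin k, (i : ℕ) < m → v i = w i := fun i h => dif_pos h
  have v2 : ∀ i : Fin k, ¬ (i : ℕ) < m → v i ∈ H := by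
    intro i h
    simp only [v, dif_neg h]
    exact (H.equivFin.symm _).2
  have hv : Function.Injective v := by
    intro i j hij
    by_cases h : (i : ℕ) < m <;> by_cases h' : (j : ℕ) < m
    · rw [v1 i h, v1 j h'] at hij; exact hwinj i j h h' hij
    · have := v2 j h'; rw [← hij, v1 i h] at this; exact absurd this (hwH i h)
    · have := v2 i h; rw [hij, v1 j h'] at this; exact absurd this (hwH j h')
    · simp only [v, dif_neg h, dif_neg h'] at hij
      have := H.equivFin.symm.injective (Subtype.ext hij)
      simp only [Fin.mk.injEq] at this
      ext; omega
  let S' : Fin k → Finset V := fun i => if (i : ℕ) < m then S i else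
    G.neighborFinset (v i) \ Finset.univ.image v
  have hS' : ∀ i, ∀ x ∈ S' i, G.Adj (v i) x ∧ ∀ j, x ≠ v j := by
    intro i x hx
    by_cases h : (i : ℕ) < m
    · simp only [S', if_pos h] at hx
      obtain ⟨h1, h2, h3⟩ := hS i h x hx
      refine ⟨by rw [v1 i h]; exact h1, fun j hj => ?_⟩
      by_cases h' : (j : ℕ) < m
      · exact h3 j h' (hj.trans (v1 j h'))
      · exact h2 (hj ▸ v2 j h')
    · simp only [S', if_neg h] at hx
      rw [Finset.mem_sdiff, SimpleGraph.mem_neighborFinset] at hx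
      exact ⟨hx.1, fun j hj => hx.2 (hj ▸ Finset.mem_image_of_mem _ (Finset.mem_univ _))⟩
  have hL' : Sel S' (fun i x => c s(v i, x)) a I L := by
    refine ⟨?_, hL.card, hL.disj, ?_⟩
    · intro i hi
      simp only [S', if_pos ((hmI i).1 hi)]
      exact hL.sub i hi
    · intro i hi j hj x hx y hy h
      simp only [v1 i ((hmI i).1 hi), v1 j ((hmI j).1 hj)] at h
      exact hL.rb i hi j hj x hx y hy h
  obtain ⟨L', hL'', -⟩ := hL'.extend (∑ i, a i) Finset.univ
    (fun i => col_injOn hc _ _ fun x hx => (hS' i x hx).1)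
    (Finset.sum_le_sum_of_subset (Finset.subset_univ _)) (by
      intro i _ hi
      right
      rw [hmI] at hi
      simp only [S', if_neg hi]
      have h1 := hH _ (v2 i hi)
      have h2 := Finset.le_card_sdiff (Finset.univ.image v) (G.neighborFinset (v i))
      have h3 : (Finset.univ.image v).card ≤ k := Finset.card_image_le.trans (by simp)
      rw [SimpleGraph.card_neighborFinset_eq_degree] at h2
      omega)
  rw [Finset.union_eq_right.2 (Finset.subset_univ _)] at hL''
  exact rainbow_of_sel G c hc a v hv S' L' hS' hL''

lemma exists_far {V : Type*} [DecidableEq V] [Nonempty V] (B : V → Finset V)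
    (hsymm : ∀ x y, x ∈ B y → y ∈ B x) (D : ℕ) (hD : ∀ x, (B x).card ≤ D) (X Q : Finset V)
    (m : ℕ) (hQ : (X.card + m * D) * D < Q.card) :
    ∃ w : ℕ → V, (∀ i < m, w i ∈ Q ∧ Disjoint (B (w i)) X) ∧
      ∀ i < m, ∀ j < m, i ≠ j → Disjoint (B (w i)) (B (w j)) := by
  induction m with
  | zero => exact ⟨fun _ => Classical.arbitrary V, by simp, by simp⟩
  | succ m ih =>
    obtain ⟨w, hw1, hw2⟩ := ih (lt_of_le_of_lt (by gcongr; omega) hQ)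
    let Y := X ∪ (Finset.range m).biUnion fun i => B (w i)
    have hY : Y.card ≤ X.card + m * D := by
      refine (Finset.card_union_le _ _).trans (Nat.add_le_add_left ?_ _)
      refine (Finset.card_biUnion_le_card_mul _ _ D fun i _ => hD _).trans (by simp)
    have hZ : (Y.biUnion B).card ≤ (X.card + (m + 1) * D) * D := by
      refine (Finset.card_biUnion_le_card_mul _ _ D fun i _ => hD _).trans ?_
      gcongr
      refine hY.trans ?_
      gcongr
      omega
    obtain ⟨x, hxQ, hxZ⟩ := Finset.exists_mem_notMem_of_card_lt_card (hZ.trans_lt hQ)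
    have hxY : Disjoint (B x) Y := by
      rw [Finset.disjoint_left]
      intro y hy hyY
      exact hxZ (Finset.mem_biUnion.2 ⟨y, hyY, hsymm _ _ hy⟩)
    have hxX : Disjoint (B x) X := hxY.mono_right Finset.subset_union_left
    have hxw : ∀ i < m, Disjoint (B x) (B (w i)) := fun i hi =>
      hxY.mono_right ((Finset.subset_biUnion_of_mem (fun i => B (w i))
        (Finset.mem_range.2 hi)).trans Finset.subset_union_right)
    refine ⟨fun i => if i = m then x else w i, ?_, ?_⟩
    · intro i hi
      by_cases h : i = m
      · simp only [if_pos h]; exact ⟨hxQ, hxX⟩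
      · simp only [if_neg h]; exact hw1 i (by omega)
    · intro i hi j hj hij
      by_cases h : i = m <;> by_cases h' : j = m
      · omega
      · simp only [if_pos h, if_neg h']; exact hxw j (by omega)
      · simp only [if_neg h, if_pos h']; exact (hxw i (by omega)).symm
      · simp only [if_neg h, if_neg h']; exact hw2 i (by omega) j (by omega) hij

/-- delete all edges touching `H` -/
def avoidGraph {V : Type*} (G : SimpleGraph V) (H : Finset V) : SimpleGraph V where
  Adj x y := G.Adj x y ∧ x ∉ H ∧ y ∉ H
  symm := ⟨fun _ _ h => ⟨h.1.symm, h.2.2, h.2.1⟩⟩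
  loopless := ⟨fun _ h => h.1.ne rfl⟩

open scoped Classical in
lemma rainbow_of_many {V : Type*} [Fintype V] (G : SimpleGraph V) (c : Sym2 V → ℕ)
    (hc : IsProperEdgeColoring G c) {k : ℕ} (hk : 0 < k) (a : Fin k → ℕ) (h1 : a ⟨0, hk⟩ = 1)
    (hpos : ∀ i, 1 ≤ a i) (H : Finset V) (m : ℕ) (hm0 : 0 < m)
    (hm : H.card + m = k) (hH : ∀ x ∈ H, 2 * ∑ i, a i + k ≤ G.degree x)
    (Δ : ℕ) (hΔ : ∀ x, (avoidGraph G H).degree x ≤ Δ) (s' : ℕ)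
    (hs' : s' = ∑ i ∈ Finset.univ.filter (fun i : Fin k => (i : ℕ) < m), a i)
    (Q : Finset V) (hQ : ∀ x ∈ Q, x ∉ H ∧ s' ≤ (avoidGraph G H).degree x + 1)
    (hQc : (2 * s' + k * (Δ + 1)) * (Δ + 1) < Q.card)
    (hcol : s' ≤ ((avoidGraph G H).edgeFinset.image c).card) :
    HasRainbowCopy (starForest a) G c := by
  set G' := avoidGraph G H with hG'
  set I : Finset (Fin k) := Finset.univ.filter fun i : Fin k => (i : ℕ) < m with hI
  have hmI : ∀ i, i ∈ I ↔ (i : ℕ) < m := by intro i; simp [hI]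
  obtain ⟨C, hCsub, hCc⟩ := Finset.exists_subset_card_eq hcol
  have hCe : ∀ t ∈ C, ∃ x y, G'.Adj x y ∧ c s(x, y) = t := by
    intro t ht
    obtain ⟨e, he, het⟩ := Finset.mem_image.1 (hCsub ht)
    induction e using Sym2.ind with | _ x y
    exact ⟨x, y, by simpa using he, het⟩
  have hQne : Q.Nonempty := Finset.card_pos.1 (by omega)
  have : Nonempty V := ⟨hQne.choose⟩
  choose! p q hpq hpqc using hCe
  let X := C.biUnion fun t => ({p t, q t} : Finset V)
  have hX : X.card ≤ 2 * s' := by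
    refine (Finset.card_biUnion_le_card_mul _ _ 2 fun t _ => Finset.card_le_two).trans ?_
    omega
  have hXm : ∀ t ∈ C, p t ∈ X ∧ q t ∈ X := fun t ht =>
    ⟨Finset.mem_biUnion.2 ⟨t, ht, by simp⟩, Finset.mem_biUnion.2 ⟨t, ht, by simp⟩⟩
  let B : V → Finset V := fun x => insert x (G'.neighborFinset x)
  have hBself : ∀ x, x ∈ B x := fun x => Finset.mem_insert_self _ _
  have hBadj : ∀ x y, G'.Adj x y → y ∈ B x := fun x y h => by simp [B, h]
  have hmk : m ≤ k := by omega
  obtain ⟨w, hw1, hw2⟩ := exists_far B (by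
      intro x y h
      simp only [B, Finset.mem_insert, SimpleGraph.mem_neighborFinset] at h ⊢
      exact h.imp Eq.symm SimpleGraph.Adj.symm) (Δ + 1) (by
      intro x
      refine (Finset.card_insert_le _ _).trans ?_
      rw [SimpleGraph.card_neighborFinset_eq_degree]
      exact Nat.add_le_add_right (hΔ x) 1) X Q m (by
      refine lt_of_le_of_lt ?_ hQc
      gcongr)
  have hs1 : 1 ≤ s' := by
    rw [hs', ← h1]
    exact Finset.single_le_sum (f := a) (fun _ _ => Nat.zero_le _) ((hmI ⟨0, hk⟩).2 hm0)
  -- the selection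
  have main : ∀ t ∈ C, ∀ (v : Fin k → V) (S : Fin k → Finset V),
      v = (fun i : Fin k => if (i : ℕ) = 0 then p t else w i) →
      S = (fun i : Fin k => if (i : ℕ) = 0 then {q t} else G'.neighborFinset (w i)) →
      (∃ L, Sel S (fun i x => c s(v i, x)) a I L) → HasRainbowCopy (starForest a) G c := by
    intro t ht v S hv hS ⟨L, hL⟩
    obtain ⟨hpX, hqX⟩ := hXm t ht
    have hv0 : ∀ i : Fin k, (i : ℕ) = 0 → v i = p t := fun i hi => by rw [hv]; simp [hi]
    have hv1 : ∀ i : Fin k, (i : ℕ) ≠ 0 → v i = w i := fun i hi => by rw [hv]; simp [hi]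
    have hS0 : ∀ i : Fin k, (i : ℕ) = 0 → S i = {q t} := fun i hi => by rw [hS]; simp [hi]
    have hS1 : ∀ i : Fin k, (i : ℕ) ≠ 0 → S i = G'.neighborFinset (w i) := fun i hi => by
      rw [hS]; simp [hi]
    have hnX : ∀ i < m, ∀ y ∈ B (w i), ∀ x ∈ X, y ≠ x := fun i hi y hy x hx e =>
      Finset.disjoint_left.1 (hw1 i hi).2 hy (e ▸ hx)
    have hnB : ∀ i < m, ∀ j < m, i ≠ j → ∀ y ∈ B (w i), ∀ x ∈ B (w j), y ≠ x :=
      fun i hi j hj hij y hy x hx e => Finset.disjoint_left.1 (hw2 i hi j hj hij) hy (e ▸ hx)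
    refine rainbow_of_low G c hc a H m hm hH v S L ?_ ?_ ?_ hL
    · intro i hi
      by_cases h : (i : ℕ) = 0
      · rw [hv0 i h]; exact (hpq t ht).2.1
      · rw [hv1 i h]; exact (hQ _ (hw1 _ hi).1).1
    · intro i j hi hj hij
      by_cases h : (i : ℕ) = 0 <;> by_cases h' : (j : ℕ) = 0
      · ext; omega
      · rw [hv0 i h, hv1 j h'] at hij
        exact absurd hij.symm (hnX _ hj _ (hBself _) _ hpX)
      · rw [hv1 i h, hv0 j h'] at hij
        exact absurd hij (hnX _ hi _ (hBself _) _ hpX)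
      · rw [hv1 i h, hv1 j h'] at hij
        by_contra hne
        exact hnB i hi j hj (fun e => hne (Fin.ext e)) _ (hBself _) _ (hBself _) hij
    · intro i hi x hx
      by_cases h : (i : ℕ) = 0
      · rw [hS0 i h, Finset.mem_singleton] at hx
        subst hx
        rw [hv0 i h]
        refine ⟨(hpq t ht).1, (hpq t ht).2.2, fun j hj => ?_⟩
        by_cases h' : (j : ℕ) = 0
        · rw [hv0 j h']; exact (hpq t ht).ne.symm
        · rw [hv1 j h']; exact (hnX _ hj _ (hBself _) _ hqX).symm
      · rw [hS1 i h, SimpleGraph.mem_neighborFinset] at hx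
        rw [hv1 i h]
        refine ⟨hx.1, hx.2.2, fun j hj => ?_⟩
        by_cases h' : (j : ℕ) = 0
        · rw [hv0 j h']; exact hnX _ hi _ (hBadj _ _ hx) _ hpX
        · rw [hv1 j h']
          by_cases e : (i : ℕ) = j
          · rw [← e]; exact hx.ne.symm
          · exact hnB i hi j hj e _ (hBadj _ _ hx) _ (hBself _)
  have start : ∀ t ∈ C, ∀ (v : Fin k → V) (S : Fin k → Finset V),
      v = (fun i : Fin k => if (i : ℕ) = 0 then p t else w i) →
      S = (fun i : Fin k => if (i : ℕ) = 0 then {q t} else G'.neighborFinset (w i)) →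
      (∀ i, Set.InjOn (fun x => c s(v i, x)) (S i)) ∧
      Sel S (fun i x => c s(v i, x)) a {⟨0, hk⟩} (fun _ => {q t}) ∧
      (∀ i ∈ I, i ≠ ⟨0, hk⟩ → ∀ j ∈ I, j ≠ i → Disjoint (S i) (S j)) := by
    intro t ht v S hv hS
    refine ⟨?_, ⟨?_, ?_, ?_, ?_⟩, ?_⟩
    · intro i
      by_cases h : (i : ℕ) = 0
      · rw [hS]; simp [h]
      · rw [hS, hv]
        simp only [h, if_false]
        exact col_injOn hc _ _ fun x hx => ((SimpleGraph.mem_neighborFinset _ _ _).1 hx).1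
    · intro i hi; rw [Finset.mem_singleton] at hi; subst hi; rw [hS]; simp
    · intro i hi; rw [Finset.mem_singleton] at hi; subst hi; rw [h1]; simp
    · intro i hi j hj; rw [Finset.mem_singleton] at hi hj; intros; rw [hi, hj]
    · intro i hi j hj; rw [Finset.mem_singleton] at hi hj; intros; rw [hi, hj]
    · intro i hi hi0 j hj hji
      have h : (i : ℕ) ≠ 0 := fun h => hi0 (Fin.ext h)
      rw [hS]
      simp only [h, if_false]
      have hsB : G'.neighborFinset (w i) ⊆ B (w i) := Finset.subset_insert _ _
      by_cases h' : (j : ℕ) = 0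
      · simp only [h', if_true]
        refine ((hw1 i ((hmI i).1 hi)).2.mono_left hsB).mono_right ?_
        simpa using (hXm t ht).2
      · simp only [h', if_false]
        exact ((hw2 i ((hmI i).1 hi) j ((hmI j).1 hj) (fun e => hji (Fin.ext e.symm))).mono_left
          hsB).mono_right (Finset.subset_insert _ _)
  have hI0 : {⟨0, hk⟩} ∪ I = I := Finset.union_eq_right.2 (by
    rw [Finset.singleton_subset_iff, hmI]; exact hm0)
  by_cases hcase : ∃ t ∈ C, ∃ j ∈ I, j ≠ ⟨0, hk⟩ ∧ ∀ z ∈ G'.neighborFinset (w j), c s(w j, z) ≠ t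
  · obtain ⟨t, ht, j, hjI, hj0, hj⟩ := hcase
    refine main t ht _ _ rfl rfl ?_
    obtain ⟨hinj, hsel, hdisj⟩ := start t ht _ _ rfl rfl
    have hjn : (j : ℕ) ≠ 0 := fun h => hj0 (Fin.ext h)
    have hI0' : {⟨0, hk⟩} ∪ I.erase j = I.erase j := Finset.union_eq_right.2 (by
      rw [Finset.singleton_subset_iff, Finset.mem_erase, hmI]; exact ⟨hj0.symm, hm0⟩)
    have hsum : a j + ∑ i ∈ I.erase j, a i = s' := by rw [hs']; exact Finset.add_sum_erase _ _ hjI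
    have hcardS : ∀ i ∈ I, s' ≤ (G'.neighborFinset (w i)).card + 1 := fun i hi => by
      rw [SimpleGraph.card_neighborFinset_eq_degree]
      exact (hQ _ (hw1 _ ((hmI i).1 hi)).1).2
    obtain ⟨L, hL, hLe⟩ := hsel.extend (s' - 1) (I.erase j) hinj (by
        rw [hI0']; have := hpos j; omega) (by
        intro i hi hi0
        left
        rw [Finset.mem_singleton] at hi0
        have hin : (i : ℕ) ≠ 0 := fun h => hi0 (Fin.ext h)
        have hiI := Finset.mem_of_mem_erase hi
        refine ⟨?_, fun j' hj' hne => hdisj i hiI hi0 j' ?_ hne⟩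
        · simp only [hin, if_false]
          have := hcardS i hiI
          omega
        · rw [hI0'] at hj'; exact Finset.mem_of_mem_erase hj')
    rw [hI0'] at hL
    have h0m : (⟨0, hk⟩ : Fin k) ∈ I.erase j := by
      rw [Finset.mem_erase, hmI]; exact ⟨hj0.symm, hm0⟩
    have htu : t ∈ usedCol (fun (i : Fin k) x => c s(if (i : ℕ) = 0 then p t else w i, x))
        (I.erase j) L := by
      refine Finset.mem_biUnion.2 ⟨⟨0, hk⟩, h0m, ?_⟩
      rw [hLe _ (Finset.mem_singleton_self _)]
      simp [hpqc t ht]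
    obtain ⟨L', hL', -⟩ := hL.step j (Finset.notMem_erase _ _) (G'.neighborFinset (w j))
      (by simp [hjn]) (by simpa [hjn] using hinj j) (by
        intro i hi x hx hx'
        refine Finset.disjoint_left.1 (hdisj j hjI hj0 i (Finset.mem_of_mem_erase hi)
          (Finset.ne_of_mem_erase hi)) ?_ (hL.sub i hi hx')
        simpa [hjn] using hx) ((usedCol _ (I.erase j) L).erase t) (by
        intro x hx hx'
        refine Finset.mem_erase.2 ⟨?_, hx'⟩
        simpa [hjn] using hj x hx) (by
        have e1 := Finset.card_erase_add_one htu
        have e2 := hL.used_card_le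
        have e3 := hcardS j hjI
        omega)
    rw [Finset.insert_erase hjI] at hL'
    exact ⟨L', hL'⟩
  · push Not at hcase
    obtain ⟨t, ht⟩ : C.Nonempty := Finset.card_pos.1 (by omega)
    refine main t ht _ _ rfl rfl ?_
    obtain ⟨hinj, hsel, hdisj⟩ := start t ht _ _ rfl rfl
    obtain ⟨L, hL, -⟩ := hsel.extend s' I hinj (by rw [hI0, hs']) (by
        intro i hi hi0
        left
        rw [Finset.mem_singleton] at hi0
        have hin : (i : ℕ) ≠ 0 := fun h => hi0 (Fin.ext h)
        refine ⟨?_, fun j' hj' hne => hdisj i hi hi0 j' (by rwa [hI0] at hj') hne⟩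
        simp only [hin, if_false]
        rw [← hCc]
        have hsub : C ⊆ (G'.neighborFinset (w i)).image fun z => c s(w i, z) := by
          intro u hu
          obtain ⟨z, hz, hzu⟩ := hcase u hu i hi hi0
          exact Finset.mem_image.2 ⟨z, hz, hzu⟩
        exact (Finset.card_le_card hsub).trans Finset.card_image_le)
    rw [hI0] at hL
    exact ⟨L, hL⟩

open scoped Classical in
lemma matching_bound {V : Type*} [Fintype V] (G : SimpleGraph V) (c : Sym2 V → ℕ)
    (hc : IsProperEdgeColoring G c) (W : Finset V) (hW : ∀ x y, G.Adj x y → x ∈ W) :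
    G.edgeFinset.card ≤ (G.edgeFinset.image c).card * (W.card / 2) := by
  rw [mul_comm]
  refine Finset.card_le_mul_card_image _ _ fun t _ => ?_
  rw [Nat.le_div_iff_mul_le (by norm_num)]
  set M := G.edgeFinset.filter (fun e => c e = t) with hM
  have hMe : ∀ e ∈ M, e ∈ G.edgeSet ∧ c e = t := fun e he => by simpa [hM] using he
  have h1 : (M.biUnion fun e => e.toFinset).card = M.card * 2 := by
    rw [Finset.card_biUnion, Finset.sum_const_nat (m := 2)]
    · intro e he
      exact Sym2.card_toFinset_of_not_isDiag e (G.not_isDiag_of_mem_edgeSet (hMe e he).1)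
    · intro e he e' he' hne
      refine Finset.disjoint_left.2 ?_
      intro x hx hx'
      rw [Sym2.mem_toFinset] at hx hx'
      exact hc (hMe e he).1 (hMe e' he').1 hne ⟨x, hx, hx'⟩ ((hMe e he).2.trans (hMe e' he').2.symm)
  rw [← h1]
  refine Finset.card_le_card fun x hx => ?_
  obtain ⟨e, he, hxe⟩ := Finset.mem_biUnion.1 hx
  rw [Sym2.mem_toFinset] at hxe
  obtain ⟨y, rfl⟩ := Sym2.mem_iff_exists.1 hxe
  exact hW x y (hMe _ he).1

open scoped Classical in
lemma avoid_count {V : Type*} [Fintype V] (G : SimpleGraph V) (H : Finset V) :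
    2 * G.edgeFinset.card ≤ H.card * (Fintype.card V - 1) +
      (Fintype.card V - H.card) * H.card + 2 * (avoidGraph G H).edgeFinset.card := by
  rw [← SimpleGraph.sum_degrees_eq_twice_card_edges, ← SimpleGraph.sum_degrees_eq_twice_card_edges,
    ← Finset.sum_add_sum_compl H (fun v => G.degree v)]
  have h1 : ∑ v ∈ H, G.degree v ≤ H.card * (Fintype.card V - 1) := by
    have := Finset.sum_le_card_nsmul H (fun v => G.degree v) (Fintype.card V - 1) (fun v _ => by
      have := G.degree_lt_card_verts v; omega)
    simpa using this
  have h2 : ∑ v ∈ Hᶜ, G.degree v ≤ ∑ v ∈ Hᶜ, (H.card + (avoidGraph G H).degree v) := by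
    refine Finset.sum_le_sum fun v hv => ?_
    rw [← SimpleGraph.card_neighborFinset_eq_degree, ← SimpleGraph.card_neighborFinset_eq_degree]
    refine (Finset.card_le_card (t := H ∪ (avoidGraph G H).neighborFinset v) ?_).trans
      (Finset.card_union_le _ _)
    intro x hx
    rw [SimpleGraph.mem_neighborFinset] at hx
    rw [Finset.mem_union, SimpleGraph.mem_neighborFinset]
    by_cases hxH : x ∈ H
    · exact Or.inl hxH
    · exact Or.inr ⟨hx, Finset.mem_compl.1 hv, hxH⟩
  rw [Finset.sum_add_distrib] at h2
  have h3 : ∑ v ∈ Hᶜ, (avoidGraph G H).degree v ≤ ∑ v, (avoidGraph G H).degree v :=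
    Finset.sum_le_sum_of_subset (Finset.subset_univ _)
  have h4 : ∑ _v ∈ Hᶜ, H.card = (Fintype.card V - H.card) * H.card := by
    rw [Finset.sum_const, Finset.card_compl, smul_eq_mul]
  omega

lemma two_choose_two (m : ℕ) : 2 * Nat.choose m 2 = m * (m - 1) := by
  rw [Nat.choose_two_right]
  exact Nat.two_mul_div_two_of_even (Nat.even_mul_pred_self m)

lemma arith_final (n h m' p q b e e' k : ℕ) (hh : 1 ≤ h) (hk : h + (m' + 1) = k)
    (hq : h * b ≤ q) (hp : p ≤ m' * b)
    (he : 2 * e ≤ h * (n - 1) + (n - h) * h + 2 * e') (he' : e' ≤ p * ((n - h) / 2))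
    (hn : 10 * k ^ 2 + 10 * k ≤ n) :
    e ≤ max ((p + q) * (n / 2)) (Nat.choose (k - 1) 2 + (k - 1) * (n - k + 1)) := by
  obtain ⟨r, rfl⟩ : ∃ r, n = r + m' + h := ⟨n - h - m', by
    have : h + m' ≤ n := by nlinarith
    omega⟩
  obtain ⟨g, rfl⟩ : ∃ g, h = g + 1 := ⟨h - 1, by omega⟩
  subst hk
  have c2 := two_choose_two (g + 1 + m')
  have E1 : g + 1 + (m' + 1) - 1 = g + 1 + m' := by omega
  have E2 : r + m' + (g + 1) - (g + 1 + (m' + 1)) + 1 = r := by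
    have : 1 ≤ r := by nlinarith
    omega
  have E3 : g + 1 + m' - 1 = g + m' := by omega
  rw [E1, E2]
  rw [E3] at c2
  have E4 : r + m' + (g + 1) - 1 = r + m' + g := by omega
  have E5 : r + m' + (g + 1) - (g + 1) = r + m' := by omega
  rw [E4, E5] at he
  rw [E5] at he'
  have he2 : 2 * e' ≤ p * (r + m') := by
    have := Nat.mul_le_mul_left p (Nat.mul_div_le (r + m') 2)
    nlinarith
  have hfl : r + m' + g ≤ 2 * ((r + m' + (g + 1)) / 2) := by omega
  have hF := Nat.mul_le_mul_left (p + q) hfl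
  generalize (r + m' + (g + 1)) / 2 = f at hF
  have hr : 5 * (g + m' + 2) ^ 2 ≤ r := by nlinarith
  have h0 : 2 * e ≤ (2 * (g + 1) + p) * (r + m') + (g + 1) * g := by nlinarith
  clear hn he he' he2 hfl
  rcases Nat.lt_or_ge 2 b with hb | hb
  · refine le_max_of_le_left ?_
    have hq3 : (g + 1) * 3 ≤ q := (Nat.mul_le_mul_left (g + 1) hb).trans hq
    have h5 : (p + (g + 1) * 3) * (r + m' + g) ≤ (p + q) * (r + m' + g) := by gcongr
    have h6 : (p + (g + 1) * 3) * (r + m' + g) = (2 * (g + 1) + p) * (r + m') + (g + 1) * g +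
      ((g + 1) * (r + m') + p * g + 2 * (g + 1) * g) := by ring
    have h7 : (p + q) * (2 * f) = 2 * ((p + q) * f) := by ring
    omega
  have hp2 : p ≤ m' * 2 := hp.trans (Nat.mul_le_mul_left _ hb)
  have h9 : 2 * ((g + 1 + m').choose 2 + (g + 1 + m') * r) =
      (g + 1 + m') * (g + m') + 2 * (g + 1 + m') * r := by rw [mul_add, c2]; ring
  rcases hp2.lt_or_eq with hlt | heq
  · refine le_max_of_le_right ?_
    have h5 : (2 * (g + 1) + p + 1) * (r + m') ≤ (2 * (g + 1) + m' * 2) * (r + m') := by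
      gcongr ?_ * _; omega
    have h6 : 2 * (g + 1 + m') * m' + (g + 1) * g ≤ 5 * (g + m' + 2) ^ 2 := by
      have : 5 * (g + m' + 2) ^ 2 = (2 * (g + 1 + m') * m' + (g + 1) * g) + 
        (4 * g ^ 2 + 3 * m' ^ 2 + 8 * g * m' + 19 * g + 18 * m' + 20) := by ring
      omega
    have h7 : (2 * (g + 1) + p + 1) * (r + m') = (2 * (g + 1) + p) * (r + m') + (r + m') := by ring
    have h8 : (2 * (g + 1) + m' * 2) * (r + m') =
      2 * (g + 1 + m') * r + 2 * (g + 1 + m') * m' := by ring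
    omega
  · rcases Nat.eq_zero_or_pos m' with hm' | hm'
    · refine le_max_of_le_right ?_
      subst hm'
      rw [Nat.zero_mul] at heq
      subst heq
      have h7 : (2 * (g + 1) + 0) * (r + 0) + (g + 1) * g =
        (g + 1 + 0) * (g + 0) + 2 * (g + 1 + 0) * r := by ring
      omega
    · refine le_max_of_le_left ?_
      have hb2 : 2 ≤ b := by
        rw [heq] at hp
        exact Nat.le_of_mul_le_mul_left hp hm'
      have hq2 : (g + 1) * 2 ≤ q := (Nat.mul_le_mul_left (g + 1) hb2).trans hq
      have h5 : (p + (g + 1) * 2) * (r + m' + g) ≤ (p + q) * (r + m' + g) := by gcongr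
      have h6 : (p + (g + 1) * 2) * (r + m' + g) = (2 * (g + 1) + p) * (r + m') + (g + 1) * g +
        (p * g + (g + 1) * g) := by ring
      have h7 : (p + q) * (2 * f) = 2 * ((p + q) * f) := by ring
      omega

open scoped Classical in
lemma upper_bound {k : ℕ} (hk : 0 < k)
    (a : Fin k → ℕ) (ha : Monotone a) (h1 : a ⟨0, hk⟩ = 1) :
    ∃ N : ℕ, ∀ (V : Type) [Fintype V] (G : SimpleGraph V) (c : Sym2 V → ℕ), N ≤ Fintype.card V →
      IsProperEdgeColoring G c → ¬ HasRainbowCopy (starForest a) G c →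
      G.edgeFinset.card ≤ max ((∑ i, a i - 1) * (Fintype.card V / 2))
          (Nat.choose (k - 1) 2 + (k - 1) * (Fintype.card V - k + 1)) := by
  have hpos : ∀ i, 1 ≤ a i := fun i => h1 ▸ ha (show (⟨0, hk⟩ : Fin k) ≤ i from Nat.zero_le _)
  set s := ∑ i, a i with hs
  set D := 2 * s + k with hD
  set M := (2 * s + k * (D + 1)) * (D + 1) with hM
  refine ⟨(D + 1) * M + s + k + (10 * k ^ 2 + 10 * k), fun V _ G c hN hc hno => ?_⟩
  set n := Fintype.card V with hn
  set H : Finset V := Finset.univ.filter fun v => D ≤ G.degree v with hH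
  have hHd : ∀ x ∈ H, 2 * s + k ≤ G.degree x := fun x hx => (Finset.mem_filter.1 hx).2
  have hHk : H.card < k := by
    by_contra hcon
    push Not at hcon
    obtain ⟨H', hH', hH'c⟩ := Finset.exists_subset_card_eq hcon
    have hne : H'.Nonempty := Finset.card_pos.1 (by omega)
    refine hno (rainbow_of_low G c hc a H' 0 (by omega) (fun x hx => hHd x (hH' hx))
      (fun _ => hne.choose) (fun _ => ∅) (fun _ => ∅) (by simp) (by simp) (by simp)
      ⟨by simp, by simp, by simp, by simp⟩)
  obtain ⟨m', hm'⟩ : ∃ m', H.card + (m' + 1) = k := ⟨k - H.card - 1, by omega⟩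
  set I : Finset (Fin k) := Finset.univ.filter (fun i : Fin k => (i : ℕ) < m' + 1) with hI
  have hmI : ∀ i, i ∈ I ↔ (i : ℕ) < m' + 1 := by intro i; simp [hI]
  have hIc : I.card = m' + 1 := by
    have := Fin.card_filter_val_lt (n := k) (m := m' + 1)
    rw [hI, this]; omega
  have h0I : (⟨0, hk⟩ : Fin k) ∈ I := (hmI _).2 (Nat.succ_pos _)
  set s' := ∑ i ∈ I, a i with hs'
  have hss : s' + ∑ i ∈ Iᶜ, a i = s := Finset.sum_add_sum_compl _ _
  have hs0 : 1 + ∑ i ∈ I.erase ⟨0, hk⟩, a i = s' := by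
    rw [← h1]; exact Finset.add_sum_erase _ _ h0I
  set G' := avoidGraph G H with hG'
  have hadj : ∀ x y, G'.Adj x y → x ∈ Hᶜ := fun x y h => Finset.mem_compl.2 h.2.1
  have hΔ : ∀ x, G'.degree x ≤ D := by
    intro x
    by_cases hx : x ∈ H
    · have : G'.degree x = 0 := by
        rw [← SimpleGraph.card_neighborFinset_eq_degree, Finset.card_eq_zero,
          Finset.eq_empty_iff_forall_notMem]
        intro y hy
        rw [SimpleGraph.mem_neighborFinset] at hy
        exact hy.2.1 hx
      omega
    · have h2 : G'.degree x ≤ G.degree x := by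
        rw [← SimpleGraph.card_neighborFinset_eq_degree, ← SimpleGraph.card_neighborFinset_eq_degree]
        refine Finset.card_le_card fun y hy => ?_
        rw [SimpleGraph.mem_neighborFinset] at hy ⊢
        exact hy.1
      have h3 : ¬ D ≤ G.degree x := fun h => hx (Finset.mem_filter.2 ⟨Finset.mem_univ _, h⟩)
      omega
  set Q : Finset V := Finset.univ.filter fun x => x ∉ H ∧ s' ≤ G'.degree x + 1 with hQ
  have hQm : ∀ x, x ∈ Q ↔ x ∉ H ∧ s' ≤ G'.degree x + 1 := fun x => by simp [hQ]
  have hc' : IsProperEdgeColoring G' c := by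
    intro e₁ e₂ he₁ he₂
    have hle : G' ≤ G := fun x y h => h.1
    exact hc (SimpleGraph.edgeSet_mono hle he₁) (SimpleGraph.edgeSet_mono hle he₂)
  have hcompl : Hᶜ.card = n - H.card := by rw [Finset.card_compl]
  have hkey : G'.edgeFinset.card ≤ (s' - 1) * ((n - H.card) / 2) := by
    rcases Nat.lt_or_ge M Q.card with hbig | hsmall
    · have hcolors : (G'.edgeFinset.image c).card ≤ s' - 1 := by
        by_contra hcon
        refine hno (rainbow_of_many G c hc hk a h1 hpos H (m' + 1) (Nat.succ_pos _) hm' hHd D hΔ s'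
          hs' Q (fun x hx => (hQm x).1 hx) (lt_of_le_of_lt ?_ hbig) ?_)
        · rw [hM]; gcongr; omega
        · change s' ≤ (G'.edgeFinset.image c).card
          omega
      have := matching_bound G' c hc' Hᶜ hadj
      rw [hcompl] at this
      exact this.trans (by gcongr)
    · have hsum : 2 * G'.edgeFinset.card + (n - H.card) ≤
          (s' - 1) * (n - H.card) + (D + 1) * M := by
        have e1 : ∑ v ∈ Hᶜ, (G'.degree v + 1) ≤
            ∑ v ∈ Hᶜ, ((s' - 1) + if v ∈ Q then D + 1 else 0) := by
          refine Finset.sum_le_sum fun v hv => ?_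
          by_cases hvQ : v ∈ Q
          · rw [if_pos hvQ]; have := hΔ v; omega
          · rw [if_neg hvQ]
            rw [hQm] at hvQ
            have := Finset.mem_compl.1 hv
            have : ¬ s' ≤ G'.degree v + 1 := fun h => hvQ ⟨this, h⟩
            omega
        rw [Finset.sum_add_distrib, Finset.sum_add_distrib] at e1
        have e2 : ∑ v ∈ Hᶜ, G'.degree v = 2 * G'.edgeFinset.card := by
          rw [← SimpleGraph.sum_degrees_eq_twice_card_edges]
          refine Finset.sum_subset (Finset.subset_univ _) fun v _ hv => ?_
          rw [← SimpleGraph.card_neighborFinset_eq_degree, Finset.card_eq_zero,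
            Finset.eq_empty_iff_forall_notMem]
          intro y hy
          rw [SimpleGraph.mem_neighborFinset] at hy
          exact hv (hadj v y hy)
        have e3 : ∑ v ∈ Hᶜ, (if v ∈ Q then D + 1 else 0) ≤ (D + 1) * M := by
          refine (Finset.sum_le_sum_of_subset (Finset.subset_univ _)).trans ?_
          rw [← Finset.sum_filter, Finset.sum_const, smul_eq_mul, mul_comm]
          refine Nat.mul_le_mul_left _ (le_trans (Finset.card_le_card ?_) hsmall)
          intro v hv
          exact (Finset.mem_filter.1 hv).2
        have e4 : ∑ _v ∈ Hᶜ, 1 = n - H.card := by simp [hcompl]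
        have e5 : ∑ _v ∈ Hᶜ, (s' - 1) = (s' - 1) * (n - H.card) := by
          rw [Finset.sum_const, smul_eq_mul, hcompl, mul_comm]
        omega
      have hr : (D + 1) * M + (s' - 1) ≤ n - H.card := by omega
      generalize (D + 1) * M = K at hsum hr
      generalize n - H.card = r at hsum hr ⊢
      generalize s' - 1 = p at hsum hr ⊢
      have h3 : r ≤ 2 * (r / 2) + 1 := by omega
      have h4 := Nat.mul_le_mul_left p h3
      have h5 : p * (2 * (r / 2) + 1) = 2 * (p * (r / 2)) + p := by ring
      omega
  have hcount := avoid_count G H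
  rw [← hn] at hcount
  rcases Nat.eq_zero_or_pos H.card with h0 | hHpos
  · refine le_max_of_le_left ?_
    have hIu : I = Finset.univ := by
      refine Finset.eq_univ_iff_forall.2 fun i => (hmI i).2 ?_
      have := i.2; omega
    have hse : s' = s := by rw [hs', hIu]
    rw [h0] at hcount hkey
    simp only [Nat.zero_mul, Nat.mul_zero, Nat.zero_add, Nat.sub_zero] at hcount hkey
    rw [← hse]
    change 2 * G.edgeFinset.card ≤ 2 * G'.edgeFinset.card at hcount
    omega
  · have hmk : m' + 1 < k := by omega
    set b := a ⟨m' + 1, hmk⟩ with hb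
    have hq : H.card * b ≤ ∑ i ∈ Iᶜ, a i := by
      have h2 : Iᶜ.card = H.card := by rw [Finset.card_compl, hIc, Fintype.card_fin]; omega
      rw [← h2, ← smul_eq_mul]
      refine Finset.card_nsmul_le_sum _ _ _ fun i hi => ha ?_
      rw [Finset.mem_compl, hmI] at hi
      exact Fin.mk_le_of_le_val (by omega)
    have hp : ∑ i ∈ I.erase ⟨0, hk⟩, a i ≤ m' * b := by
      have h2 : (I.erase ⟨0, hk⟩).card = m' := by
        rw [Finset.card_erase_of_mem h0I, hIc]; omega
      rw [← h2, ← smul_eq_mul]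
      refine Finset.sum_le_card_nsmul _ _ _ fun i hi => ha ?_
      have := (hmI i).1 (Finset.mem_of_mem_erase hi)
      exact Fin.le_def.2 (le_of_lt this)
    have hfin := arith_final n H.card m' (∑ i ∈ I.erase ⟨0, hk⟩, a i) (∑ i ∈ Iᶜ, a i) b
      G.edgeFinset.card G'.edgeFinset.card k hHpos hm' hq hp hcount
      (by rw [← hs0, Nat.add_sub_cancel_left] at hkey; exact hkey) (by omega)
    have : s - 1 = ∑ i ∈ I.erase ⟨0, hk⟩, a i + ∑ i ∈ Iᶜ, a i := by omega
    rw [this]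
    exact hfin

open scoped Classical in
lemma ncard_edges {V : Type*} [Fintype V] (G : SimpleGraph V) :
    G.edgeSet.ncard = G.edgeFinset.card := by
  rw [← SimpleGraph.coe_edgeFinset, Set.ncard_coe_finset]

def joinGraph (n t : ℕ) : SimpleGraph (Fin n) where
  Adj x y := x ≠ y ∧ ((x : ℕ) < t ∨ (y : ℕ) < t)
  symm := ⟨fun _ _ h => ⟨h.1.symm, h.2.symm⟩⟩
  loopless := ⟨fun _ h => h.1 rfl⟩

open scoped Classical in
lemma joinGraph_card (n t : ℕ) (h : t ≤ n) :
    (joinGraph n t).edgeSet.ncard = Nat.choose t 2 + t * (n - t) := by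
  rw [ncard_edges]
  have h1 := SimpleGraph.sum_degrees_eq_twice_card_edges (joinGraph n t)
  set A : Finset (Fin n) := Finset.univ.filter fun x : Fin n => (x : ℕ) < t with hA
  have hAc : A.card = t := by
    have := Fin.card_filter_val_lt (n := n) (m := t)
    rw [hA, this]; omega
  have hmA : ∀ x, x ∈ A ↔ (x : ℕ) < t := fun x => by simp [hA]
  have d1 : ∀ x ∈ A, (joinGraph n t).degree x = n - 1 := by
    intro x hx
    rw [← SimpleGraph.card_neighborFinset_eq_degree]
    have : (joinGraph n t).neighborFinset x = Finset.univ.erase x := by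
      ext y
      rw [SimpleGraph.mem_neighborFinset]
      simp only [joinGraph, Finset.mem_erase, Finset.mem_univ, and_true]
      have := (hmA x).1 hx
      exact ⟨fun h => h.1.symm, fun h => ⟨h.symm, Or.inl this⟩⟩
    rw [this, Finset.card_erase_of_mem (Finset.mem_univ _)]
    simp
  have d2 : ∀ x ∈ Aᶜ, (joinGraph n t).degree x = t := by
    intro x hx
    rw [Finset.mem_compl, hmA] at hx
    rw [← SimpleGraph.card_neighborFinset_eq_degree]
    have : (joinGraph n t).neighborFinset x = A := by
      ext y
      rw [SimpleGraph.mem_neighborFinset, hmA]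
      simp only [joinGraph]
      refine ⟨fun h => h.2.resolve_left hx, fun h => ⟨?_, Or.inr h⟩⟩
      rintro rfl
      exact hx h
    rw [this, hAc]
  rw [← Finset.sum_add_sum_compl A, Finset.sum_congr rfl d1, Finset.sum_congr rfl d2,
    Finset.sum_const, Finset.sum_const, Finset.card_compl, hAc, Fintype.card_fin, smul_eq_mul,
    smul_eq_mul] at h1
  have h2 := two_choose_two t
  obtain ⟨r, rfl⟩ : ∃ r, n = t + r := ⟨n - t, by omega⟩
  rw [Nat.add_sub_cancel_left] at h1 ⊢
  rcases Nat.eq_zero_or_pos t with rfl | ht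
  · simp at h1 ⊢; simpa using h1
  · have e : t + r - 1 = (t - 1) + r := by omega
    rw [e, mul_add, mul_comm r t] at h1
    omega

lemma lower_join {k : ℕ} (hk : 0 < k) (a : Fin k → ℕ) (hpos : ∀ i, 1 ≤ a i) (n : ℕ) (hn : k ≤ n) :
    Nat.choose (k - 1) 2 + (k - 1) * (n - k + 1) ∈ rainbowExSet n (starForest a) := by
  classical
  refine ⟨joinGraph n (k - 1), fun e => (Fintype.equivFin (Sym2 (Fin n)) e : ℕ), ?_, ?_, ?_⟩
  · intro e₁ e₂ _ _ hne _ h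
    exact hne ((Fintype.equivFin (Sym2 (Fin n))).injective (Fin.ext h))
  · rintro ⟨f, hf, -⟩
    have hadj : ∀ i, (starForest a).Adj ⟨i, 0⟩ ⟨i, ⟨1, by have := hpos i; omega⟩⟩ := by
      intro i
      rw [starForest, SimpleGraph.fromRel_adj]
      refine ⟨?_, Or.inl ⟨rfl, rfl⟩⟩
      intro h
      simp [Fin.ext_iff] at h
    have hex : ∀ i, ∃ x : (Σ i, Fin (a i + 1)), x.1 = i ∧ (f x : ℕ) < k - 1 := by
      intro i
      rcases (hf (hadj i)).2 with h | h
      · exact ⟨_, rfl, h⟩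
      · exact ⟨_, rfl, h⟩
    choose x hx1 hx2 using hex
    have := Fintype.card_le_of_injective (fun i : Fin k => (⟨f (x i), hx2 i⟩ : Fin (k - 1))) (by
      intro i j h
      simp only [Fin.mk.injEq] at h
      have := f.injective (Fin.ext h)
      rw [← hx1 i, ← hx1 j, this])
    simp only [Fintype.card_fin] at this
    omega
  · rw [joinGraph_card n (k - 1) (by omega)]
    congr 2
    omega

lemma lower_reg {k : ℕ} (a : Fin k → ℕ) (hs : 1 ≤ ∑ i, a i) (n : ℕ)
    (hn : 2 * ∑ i, a i ≤ n) :
    (∑ i, a i - 1) * (n / 2) ∈ rainbowExSet n (starForest a) := by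
  classical
  set s := ∑ i, a i with hsdef
  set m := n / 2 with hm
  have hsm : s ≤ m := by omega
  have h2m : 2 * m ≤ n := by omega
  have hmod : ∀ i t, i < m → t < m → (i + t) % m = if i + t < m then i + t else i + t - m := by
    intro i t hi ht
    split_ifs with h
    · exact Nat.mod_eq_of_lt h
    · rw [Nat.mod_eq_sub_mod (by omega), Nat.mod_eq_of_lt (by omega)]
  have hlt : ∀ x, x % m < m := fun x => Nat.mod_lt _ (by omega)
  let u : Fin m → Fin n := fun i => ⟨i, by have := i.2; omega⟩
  let z : Fin m → ℕ → Fin n := fun i t => ⟨m + (i + t) % m, by have := hlt (i + t); omega⟩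
  let E : Fin m × Fin (s - 1) → Sym2 (Fin n) := fun q => s(u q.1, z q.1 q.2)
  have huz : ∀ i j t, u i ≠ z j t := by
    intro i j t h
    have := congrArg Fin.val h
    simp only [u, z] at this
    have := i.2
    omega
  have huinj : ∀ i j, u i = u j → i = j := by
    intro i j h
    have := congrArg Fin.val h
    exact Fin.ext this
  have hzval : ∀ (i : Fin m) (t : ℕ), t < m → (z i t : ℕ) = m + if (i : ℕ) + t < m then (i : ℕ) + t
      else i + t - m := by
    intro i t ht
    simp only [z]
    rw [hmod i t i.2 ht]
  have hzinj : ∀ i j t, t < m → z i t = z j t → i = j := by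
    intro i j t ht h
    have := congrArg Fin.val h
    rw [hzval i t ht, hzval j t ht] at this
    have := i.2
    have := j.2
    ext
    split_ifs at * <;> omega
  let col : Sym2 (Fin n) → ℕ := Sym2.lift ⟨fun x y => ((x : ℕ) - y + (y - x)) % m, by
    intro x y; simp only [add_comm]⟩
  have hcol : ∀ q, col (E q) = q.2 := by
    rintro ⟨i, t⟩
    change ((u i : ℕ) - z i t + (z i t - u i)) % m = t
    have ht : (t : ℕ) < m := by have := t.2; omega
    have hi := i.2
    rw [hzval i t ht]
    simp only [u]
    split_ifs with h
    · have : (i : ℕ) - (m + (i + t)) + (m + (i + t) - i) = t + m := by omega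
      rw [this, Nat.add_mod_right, Nat.mod_eq_of_lt ht]
    · have : (i : ℕ) - (m + (i + t - m)) + (m + (i + t - m) - i) = t := by omega
      rw [this, Nat.mod_eq_of_lt ht]
  have hE : Function.Injective E := by
    intro q q' h
    have h2 : q.2 = q'.2 := by
      have := congrArg col h
      rw [hcol, hcol] at this
      exact Fin.ext this
    have h1 : q.1 = q'.1 := by
      rcases Sym2.eq_iff.1 h with h | h
      · exact huinj _ _ h.1
      · exact absurd h.1 (huz _ _ _)
    exact Prod.ext h1 h2
  have hset : (SimpleGraph.fromEdgeSet (Set.range E)).edgeSet = Set.range E := by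
    rw [SimpleGraph.edgeSet_fromEdgeSet]
    ext e
    simp only [Set.mem_sdiff, and_iff_left_iff_imp]
    rintro ⟨q, rfl⟩ h
    exact huz _ _ _ (by simpa [E] using h)
  refine ⟨SimpleGraph.fromEdgeSet (Set.range E), col, ?_, ?_, ?_⟩
  · intro e₁ e₂ h₁ h₂ hne ⟨x, hx₁, hx₂⟩ hcc
    rw [hset] at h₁ h₂
    obtain ⟨q, rfl⟩ := h₁
    obtain ⟨q', rfl⟩ := h₂
    rw [hcol, hcol] at hcc
    refine hne (congrArg E (Prod.ext ?_ (Fin.ext hcc)))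
    rcases Sym2.mem_iff.1 hx₁ with e | e <;> rcases Sym2.mem_iff.1 hx₂ with e' | e'
    · exact huinj _ _ (e.symm.trans e')
    · exact absurd (e.symm.trans e') (huz _ _ _)
    · exact absurd (e'.symm.trans e) (huz _ _ _)
    · have ht : (q'.2 : ℕ) < m := by have := q'.2.2; omega
      rw [hcc] at e
      exact hzinj _ _ _ ht (e.symm.trans e')
  · rintro ⟨f, hf, hr⟩
    let g : (Σ i, Fin (a i)) → Sym2 (Σ i, Fin (a i + 1)) := fun y =>
      s(⟨y.1, 0⟩, ⟨y.1, Fin.succ y.2⟩)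
    have hg : ∀ y, g y ∈ (starForest a).edgeSet := by
      rintro ⟨i, t⟩
      rw [SimpleGraph.mem_edgeSet, starForest, SimpleGraph.fromRel_adj]
      refine ⟨?_, Or.inl ⟨rfl, rfl⟩⟩
      intro h
      simp [Fin.ext_iff] at h
    have hginj : Function.Injective g := by
      rintro ⟨i, t⟩ ⟨j, t'⟩ h
      rcases Sym2.eq_iff.1 h with h | h
      · have h2 := h.2
        simp only [Sigma.mk.injEq] at h2
        obtain ⟨rfl, h3⟩ := h2
        rw [Fin.succ_injective _ (eq_of_heq h3)]
      · have h2 := h.2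
        simp only [Sigma.mk.injEq] at h2
        obtain ⟨rfl, h3⟩ := h2
        exact absurd (eq_of_heq h3) (Fin.succ_ne_zero _)
    have hlt : ∀ y, col ((g y).map f) < s - 1 := by
      intro y
      have h1 : (g y).map f ∈ (SimpleGraph.fromEdgeSet (Set.range E)).edgeSet := hf (hg y)
      rw [hset] at h1
      obtain ⟨q, hq⟩ := h1
      rw [← hq, hcol]
      exact q.2.2
    have := Fintype.card_le_of_injective (fun y => (⟨_, hlt y⟩ : Fin (s - 1))) (by
      intro y y' h
      simp only [Fin.mk.injEq] at h
      exact hginj (hr _ (hg y) _ (hg y') h))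
    simp only [Fintype.card_sigma, Fintype.card_fin] at this
    omega
  · rw [hset, ← Set.image_univ, Set.ncard_image_of_injective _ hE, Set.ncard_univ,
      Nat.card_eq_fintype_card, Fintype.card_prod, Fintype.card_fin, Fintype.card_fin, mul_comm]

/-- If `F` is a forest of `k` stars with `a 0 ≤ a 1 ≤ … ≤ a (k-1)` edges and `F` contains
a star with exactly one edge, then for all sufficiently large `n`,
`ex*(n, F) = max { (a 0 + ⋯ + a (k-1) - 1)·⌊n/2⌋ , C(k-1,2) + (k-1)(n-k+1) }`. -/
theorem rainbowTuran_starForest_with_single_edge {k : ℕ} (hk : 0 < k)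
    (a : Fin k → ℕ) (ha : Monotone a) (h1 : a ⟨0, hk⟩ = 1) :
    ∃ N : ℕ, ∀ n ≥ N,
      IsGreatest (rainbowExSet n (starForest a))
        (max ((∑ i, a i - 1) * (n / 2))
          (Nat.choose (k - 1) 2 + (k - 1) * (n - k + 1))) := by
  have hpos : ∀ i, 1 ≤ a i := fun i => h1 ▸ ha (show (⟨0, hk⟩ : Fin k) ≤ i from Nat.zero_le _)
  obtain ⟨N, hN⟩ := upper_bound hk a ha h1
  refine ⟨N + k + 2 * ∑ i, a i, fun n hn => ⟨?_, ?_⟩⟩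
  · rcases max_choice ((∑ i, a i - 1) * (n / 2))
      (Nat.choose (k - 1) 2 + (k - 1) * (n - k + 1)) with h | h
    · rw [h]
      refine lower_reg a ?_ n (by omega)
      rw [← h1]
      exact Finset.single_le_sum (f := a) (fun _ _ => Nat.zero_le _) (Finset.mem_univ _)
    · rw [h]
      exact lower_join hk a hpos n (by omega)
  · rintro e ⟨G, c, hc, hno, rfl⟩
    have := hN (Fin n) G c (by rw [Fintype.card_fin]; omega) hc hno
    rw [Fintype.card_fin] at this
    rw [ncard_edges]
    exact this
end

section
/- Let F be a forest consisting of k vertex-disjoint stars with numbers of edges a_1 ≤ a_2 ≤ … ≤ a_k. Then for all sufficiently large n, the (ordinary) Turán number of F satisfies ex(n, F) = max over 0 ≤ i ≤ k−1 of { i(n−i) + C(i, 2) + ⌊(a_{k−i} − 1)(n−i)/2⌋ }. -/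
open SimpleGraph Finset

section packing
variable {V : Type*} [DecidableEq V] (G : SimpleGraph V) (d : ℕ → ℕ)

/-- `W` is the vertex set of a family of disjoint stars with `d j` edges, `j ∈ S`. -/
def HasPack (S : Finset ℕ) (W : Finset V) : Prop :=
  ∃ (c : ℕ → V) (L : ℕ → Finset V),
    (∀ j ∈ S, (∀ w ∈ L j, G.Adj (c j) w) ∧ (L j).card = d j) ∧
    (∀ i ∈ S, ∀ j ∈ S, i ≠ j → Disjoint (insert (c i) (L i)) (insert (c j) (L j))) ∧
    (S.biUnion fun j => insert (c j) (L j)) = W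

variable {G d}

theorem HasPack.empty [Nonempty V] : HasPack G d ∅ ∅ :=
  ⟨fun _ => Classical.arbitrary V, fun _ => ∅, by simp, by simp, by simp⟩

theorem HasPack.card_le {S : Finset ℕ} {W : Finset V} (h : HasPack G d S W) :
    W.card ≤ ∑ j ∈ S, (d j + 1) := by
  obtain ⟨c, L, h1, -, rfl⟩ := h
  refine Finset.card_biUnion_le.trans (Finset.sum_le_sum fun j hj => ?_)
  have := Finset.card_insert_le (c j) (L j)
  have := (h1 j hj).2
  omega

theorem HasPack.extend {S : Finset ℕ} {W : Finset V} (h : HasPack G d S W) {j : ℕ} (hj : j ∉ S)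
    {v : V} {M : Finset V} (hM : ∀ w ∈ M, G.Adj v w) (hc : M.card = d j)
    (hd : Disjoint (insert v M) W) : HasPack G d (insert j S) (insert v M ∪ W) := by
  obtain ⟨c, L, h1, h2, rfl⟩ := h
  have e1 : ∀ i ∈ S, i ≠ j := fun i hi h => hj (h ▸ hi)
  have hd' : ∀ i ∈ S, Disjoint (insert v M) (insert (c i) (L i)) := by
    rw [Finset.disjoint_biUnion_right] at hd
    exact hd
  refine ⟨Function.update c j v, Function.update L j M, ?_, ?_, ?_⟩
  · intro i hi
    rcases Finset.mem_insert.1 hi with rfl | hi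
    · simp only [Function.update_self]
      exact ⟨hM, hc⟩
    · rw [Function.update_of_ne (e1 i hi), Function.update_of_ne (e1 i hi)]
      exact h1 i hi
  · intro i hi i' hi' hne
    rw [Finset.mem_insert] at hi hi'
    rcases hi with hi | hi <;> rcases hi' with hi' | hi'
    · exact absurd (hi.trans hi'.symm) hne
    · subst hi
      simp only [Function.update_self]
      rw [Function.update_of_ne (e1 i' hi'), Function.update_of_ne (e1 i' hi')]
      exact hd' i' hi'
    · subst hi'
      simp only [Function.update_self]
      rw [Function.update_of_ne (e1 i hi), Function.update_of_ne (e1 i hi)]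
      exact (hd' i hi).symm
    · rw [Function.update_of_ne (e1 i hi), Function.update_of_ne (e1 i hi),
        Function.update_of_ne (e1 i' hi'), Function.update_of_ne (e1 i' hi')]
      exact h2 i hi i' hi' hne
  · rw [Finset.biUnion_insert]
    simp only [Function.update_self]
    congr 1
    refine Finset.biUnion_congr rfl fun i hi => ?_
    rw [Function.update_of_ne (e1 i hi), Function.update_of_ne (e1 i hi)]

/-- Greedily extend a packing, using vertices of large degree as centers. -/
theorem HasPack.greedy [Fintype V] [DecidableRel G.Adj] {k : ℕ} (T : Finset ℕ) :
    ∀ {S : Finset ℕ} {W U : Finset V}, HasPack G d S W → S ⊆ range k → T ⊆ range k →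
    Disjoint S T → Disjoint U W → U.card = T.card →
    (∀ u ∈ U, ∑ j ∈ range k, (d j + 1) + k ≤ G.degree u) → ∃ W', HasPack G d (S ∪ T) W' := by
  induction T using Finset.induction_on with
  | empty => intro S W U h _ _ _ _ _ _; exact ⟨W, by simpa using h⟩
  | insert j T hj ih =>
    intro S W U h hS hT hST hUW hc hdeg
    have hUc : U.card ≤ k := by
      rw [hc]; simpa using Finset.card_le_card hT
    rw [Finset.card_insert_of_notMem hj] at hc
    obtain ⟨u, hu⟩ : U.Nonempty := Finset.card_pos.1 (by omega)
    have hjS : j ∉ S := fun h => Finset.disjoint_left.1 hST h (Finset.mem_insert_self _ _)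
    have hjk : j ∈ range k := hT (Finset.mem_insert_self _ _)
    have h3 : ∑ i ∈ insert j S, (d i + 1) ≤ ∑ i ∈ range k, (d i + 1) :=
      Finset.sum_le_sum_of_subset (Finset.insert_subset hjk hS)
    rw [Finset.sum_insert hjS] at h3
    have h4 := h.card_le
    have h5 := hdeg u hu
    have h6 : d j ≤ (G.neighborFinset u \ (W ∪ U)).card := by
      have := Finset.le_card_sdiff (W ∪ U) (G.neighborFinset u)
      rw [G.card_neighborFinset_eq_degree] at this
      have := Finset.card_union_le W U
      omega
    obtain ⟨M, hM, hMc⟩ := Finset.exists_subset_card_eq h6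
    have hM' : ∀ w ∈ M, G.Adj u w ∧ w ∉ W ∧ w ∉ U := by
      intro w hw
      have := hM hw
      simpa using this
    have h7 := h.extend hjS (fun w hw => (hM' w hw).1) hMc (by
      rw [Finset.disjoint_insert_left, Finset.disjoint_left]
      exact ⟨Finset.disjoint_left.1 hUW hu, fun w hw => (hM' w hw).2.1⟩)
    obtain ⟨W', hW'⟩ := ih (U := U.erase u) h7 (Finset.insert_subset hjk hS)
      ((Finset.subset_insert _ _).trans hT)
      (by
        rw [Finset.disjoint_insert_left]
        exact ⟨hj, hST.mono_right (Finset.subset_insert _ _)⟩)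
      (by
        rw [Finset.disjoint_left]
        intro w hw
        have hw1 := Finset.mem_of_mem_erase hw
        have hw2 := Finset.ne_of_mem_erase hw
        simp only [Finset.mem_union, Finset.mem_insert, not_or]
        exact ⟨⟨hw2, fun hm => (hM' w hm).2.2 hw1⟩, Finset.disjoint_left.1 hUW hw1⟩)
      (by rw [Finset.card_erase_of_mem hu]; omega)
      (fun w hw => hdeg w (Finset.mem_of_mem_erase hw))
    refine ⟨W', ?_⟩
    rwa [Finset.insert_union, ← Finset.union_insert] at hW'

end packing

theorem contains_of_stars {V : Type*} [DecidableEq V] {G : SimpleGraph V} {k : ℕ} (a : Fin k → ℕ)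
    (c : Fin k → V) (L : Fin k → Finset V) (h1 : ∀ j, ∀ w ∈ L j, G.Adj (c j) w)
    (h2 : ∀ j, (L j).card = a j)
    (h3 : ∀ i j, i ≠ j → Disjoint (insert (c i) (L i)) (insert (c j) (L j))) :
    Contains (starForest a) G := by
  let e : ∀ j, Fin (a j) ≃ L j := fun j => (Finset.equivFinOfCardEq (h2 j)).symm
  let f : (Σ i, Fin (a i + 1)) → V := fun x =>
    Fin.cases (motive := fun _ => V) (c x.1) (fun y => (e x.1 y : V)) x.2
  have hf0 : ∀ j, f ⟨j, 0⟩ = c j := fun j => rfl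
  have hfs : ∀ j y, f ⟨j, Fin.succ y⟩ = e j y := fun j y => rfl
  have hmem : ∀ x, f x ∈ insert (c x.1) (L x.1) := by
    rintro ⟨j, x⟩
    refine Fin.cases ?_ (fun y => ?_) x
    · rw [hf0]; exact Finset.mem_insert_self _ _
    · rw [hfs]; exact Finset.mem_insert_of_mem (e j y).2
  have hadj : ∀ j y, G.Adj (c j) (f ⟨j, Fin.succ y⟩) := fun j y => h1 j _ (e j y).2
  have hinj : Function.Injective f := by
    rintro ⟨j, x⟩ ⟨j', x'⟩ hxx
    by_cases hj : j = j'
    · subst hj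
      congr 1
      revert hxx
      refine Fin.cases ?_ (fun y => ?_) x <;> refine Fin.cases ?_ (fun y' => ?_) x' <;> intro hxx
      · rfl
      · exact absurd hxx (hadj j y').ne
      · exact absurd hxx.symm (hadj j y).ne
      · rw [hfs, hfs] at hxx
        rw [(e j).injective (Subtype.ext hxx)]
    · exact absurd (hxx ▸ hmem ⟨j', x'⟩) (Finset.disjoint_left.1 (h3 j j' hj) (hmem ⟨j, x⟩))
  have key : ∀ x y : (Σ i, Fin (a i + 1)), x ≠ y → x.1 = y.1 → (x.2 : ℕ) = 0 →
      G.Adj (f x) (f y) := by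
    rintro ⟨j, x⟩ ⟨j', y⟩ hne hjj hx
    dsimp only at hjj hx
    subst hjj
    obtain rfl : x = 0 := Fin.ext hx
    obtain ⟨z, rfl⟩ := Fin.exists_succ_eq.2 (fun h : y = 0 => hne (by rw [h]))
    exact hadj j z
  refine ⟨⟨f, hinj⟩, ?_⟩
  intro x y hxy
  rw [starForest, SimpleGraph.fromRel_adj] at hxy
  rcases hxy with ⟨hne, h | h⟩
  · exact key x y hne h.1 h.2
  · exact (key y x hne.symm h.1 h.2).symm

theorem HasPack.contains {V : Type*} [DecidableEq V] {G : SimpleGraph V} {k : ℕ} (a : Fin k → ℕ)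
    {d : ℕ → ℕ} (had : ∀ j : Fin k, d (j.rev : ℕ) = a j) {W : Finset V}
    (h : HasPack G d (range k) W) : Contains (starForest a) G := by
  obtain ⟨c, L, h1, h2, -⟩ := h
  have hr : ∀ j : Fin k, (j.rev : ℕ) ∈ range k := fun j => Finset.mem_range.2 j.rev.2
  refine contains_of_stars a (fun j => c (j.rev : ℕ)) (fun j => L (j.rev : ℕ))
    (fun j => (h1 _ (hr j)).1) (fun j => by rw [(h1 _ (hr j)).2, had]) ?_
  intro i j hij
  exact h2 _ (hr i) _ (hr j) (fun h => hij (Fin.rev_injective (Fin.ext h)))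

/-- Degree-sum count: `U` arbitrary, vertices of `W` have degree at most `D`, other vertices have at
most `r` neighbours outside `U ∪ W`. -/
theorem two_mul_edges_le {V : Type*} [Fintype V] [DecidableEq V] (G : SimpleGraph V)
    [DecidableRel G.Adj] (U W : Finset V) (hUW : Disjoint U W) (D r : ℕ)
    (hW : ∀ w ∈ W, G.degree w ≤ D)
    (hr : ∀ v, v ∉ U → v ∉ W → (G.neighborFinset v \ (U ∪ W)).card ≤ r) :
    2 * G.edgeFinset.card ≤ U.card * (Fintype.card V - 1) + 2 * (W.card * D)
      + (Fintype.card V - U.card) * (U.card + r) := by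
  rw [← G.sum_degrees_eq_twice_card_edges]
  have h1 : ∑ v, G.degree v = ∑ v ∈ U, G.degree v + ∑ v ∈ W, G.degree v
      + ∑ v ∈ (U ∪ W)ᶜ, G.degree v := by
    rw [← Finset.sum_union hUW, Finset.sum_add_sum_compl]
  have h2 : ∑ v ∈ U, G.degree v ≤ U.card * (Fintype.card V - 1) := by
    rw [← smul_eq_mul]
    refine Finset.sum_le_card_nsmul _ _ _ fun v _ => ?_
    have := G.degree_lt_card_verts v
    omega
  have h3 : ∑ v ∈ W, G.degree v ≤ W.card * D := by
    rw [← smul_eq_mul]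
    exact Finset.sum_le_card_nsmul _ _ _ hW
  have h4 : ∑ v ∈ (U ∪ W)ᶜ, G.degree v
      ≤ ∑ v ∈ (U ∪ W)ᶜ, ((G.neighborFinset v ∩ W).card + (U.card + r)) := by
    refine Finset.sum_le_sum fun v hv => ?_
    simp only [Finset.mem_compl, Finset.mem_union, not_or] at hv
    have h := hr v hv.1 hv.2
    have hs : G.neighborFinset v ⊆
        (G.neighborFinset v ∩ W) ∪ (U ∪ (G.neighborFinset v \ (U ∪ W))) := by
      intro x hx
      by_cases h1 : x ∈ W <;> by_cases h2 : x ∈ U <;> simp_all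
    have h5 := Finset.card_le_card hs
    rw [G.card_neighborFinset_eq_degree] at h5
    have h6 := Finset.card_union_le (G.neighborFinset v ∩ W) (U ∪ (G.neighborFinset v \ (U ∪ W)))
    have h7 := Finset.card_union_le U (G.neighborFinset v \ (U ∪ W))
    omega
  rw [Finset.sum_add_distrib] at h4
  have h5 : ∑ v ∈ (U ∪ W)ᶜ, (G.neighborFinset v ∩ W).card ≤ W.card * D := by
    calc _ ≤ ∑ v, (G.neighborFinset v ∩ W).card :=
          Finset.sum_le_sum_of_subset (Finset.subset_univ _)
      _ = ∑ w ∈ W, G.degree w := by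
          have := Finset.sum_card_bipartiteAbove_eq_sum_card_bipartiteBelow
            (s := (Finset.univ : Finset V)) (t := W) G.Adj
          convert this using 3 with v _ w _
          · ext x; simp [Finset.bipartiteAbove, and_comm]
          · rw [← G.card_neighborFinset_eq_degree]
            congr 1
            ext x; simp [Finset.bipartiteBelow, G.adj_comm]
      _ ≤ _ := h3
  have h6 : ∑ v ∈ (U ∪ W)ᶜ, (U.card + r) ≤ (Fintype.card V - U.card) * (U.card + r) := by
    rw [Finset.sum_const, smul_eq_mul]
    refine Nat.mul_le_mul_right _ ?_
    rw [← Finset.card_compl]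
    exact Finset.card_le_card (Finset.compl_subset_compl.2 Finset.subset_union_left)
  omega

theorem upper_bound_s6 {k : ℕ} (a : Fin k → ℕ) (d : ℕ → ℕ)
    (had : ∀ j : Fin k, d (j.rev : ℕ) = a j) :
    ∃ N : ℕ, ∀ n ≥ N, ∀ (G : SimpleGraph (Fin n)) [DecidableRel G.Adj],
      ¬ Contains (starForest a) G →
      ∃ m < k, G.edgeFinset.card ≤ m * (n - m) + m.choose 2 + (d m - 1) * (n - m) / 2 := by
  obtain ⟨D, hD⟩ : ∃ D, D = ∑ j ∈ range k, (d j + 1) + k := ⟨_, rfl⟩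
  refine ⟨D * D + D * D + D * D + D + k + 1, fun n hn G _ hG => ?_⟩
  have : Nonempty (Fin n) := ⟨⟨0, by omega⟩⟩
  let U : Finset (Fin n) := {v | D ≤ G.degree v}
  have hUdeg : ∀ u ∈ U, ∑ j ∈ range k, (d j + 1) + k ≤ G.degree u := by
    intro u hu
    rw [← hD]
    simpa [U] using hu
  have hUlt : U.card < k := by
    by_contra! h
    obtain ⟨U', hU', hc⟩ := Finset.exists_subset_card_eq h
    obtain ⟨W, hW⟩ := HasPack.greedy (k := k) (U := U') (range k)
      (HasPack.empty (G := G) (d := d)) (by simp) (by simp) (by simp) (by simp) (by simpa using hc)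
      (fun u hu => hUdeg u (hU' hu))
    rw [Finset.empty_union] at hW
    exact hG (hW.contains a had)
  obtain ⟨i, hi⟩ : ∃ i, i = U.card := ⟨_, rfl⟩
  rw [← hi] at hUlt
  let P : ℕ → Prop := fun m => ∃ W, HasPack G d (Finset.Ico i m) W ∧ Disjoint U W
  have hPi : P i := ⟨∅, by rw [Finset.Ico_self]; exact HasPack.empty, by simp⟩
  have hPk : ¬ P k := by
    rintro ⟨W, hW, hUW⟩
    obtain ⟨W', hW'⟩ := HasPack.greedy (k := k) (U := U) (range i) hW
      (by intro x; simp) (by intro x; simp; omega)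
      (by rw [Finset.disjoint_left]; intro x; simp; omega) hUW (by simp [hi]) hUdeg
    have : Finset.Ico i k ∪ range i = range k := by ext x; simp; omega
    rw [this] at hW'
    exact hG (hW'.contains a had)
  obtain ⟨m, him, hmk, hPm, hPm'⟩ : ∃ m, i ≤ m ∧ m < k ∧ P m ∧ ¬ P (m + 1) := by
    by_contra! h
    have : ∀ j, i + j ≤ k → P (i + j) := by
      intro j
      induction j with
      | zero => intro _; exact hPi
      | succ j ih => intro hj; exact h (i + j) (by omega) (by omega) (ih (by omega))
    have h2 := this (k - i) (by omega)
    rw [Nat.add_sub_cancel' hUlt.le] at h2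
    exact hPk h2
  obtain ⟨W, hW, hUW⟩ := hPm
  have hnb : ∀ v, v ∉ U → v ∉ W → (G.neighborFinset v \ (U ∪ W)).card ≤ d m - 1 := by
    intro v hvU hvW
    by_contra! h
    have h6 : d m ≤ (G.neighborFinset v \ (U ∪ W)).card := by omega
    obtain ⟨M, hM, hMc⟩ := Finset.exists_subset_card_eq h6
    have hM' : ∀ w ∈ M, G.Adj v w ∧ w ∉ U ∧ w ∉ W := by
      intro w hw
      have := hM hw
      simpa using this
    apply hPm'
    refine ⟨insert v M ∪ W, ?_, ?_⟩
    · have := hW.extend (j := m) (by simp) (fun w hw => (hM' w hw).1) hMc (by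
        rw [Finset.disjoint_insert_left, Finset.disjoint_left]
        exact ⟨hvW, fun w hw => (hM' w hw).2.2⟩)
      have h8 : insert m (Finset.Ico i m) = Finset.Ico i (m + 1) := by ext x; simp; omega
      rwa [h8] at this
    · rw [Finset.disjoint_right]
      intro x hx
      simp only [Finset.mem_union, Finset.mem_insert] at hx
      rcases hx with (rfl | hx) | hx
      · exact hvU
      · exact (hM' x hx).2.1
      · exact Finset.disjoint_right.1 hUW hx
  have hWdeg : ∀ w ∈ W, G.degree w ≤ D := by
    intro w hw
    have : w ∉ U := Finset.disjoint_right.1 hUW hw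
    simp only [U, Finset.mem_filter, Finset.mem_univ, true_and] at this
    omega
  have key := two_mul_edges_le G U W hUW D (d m - 1) hWdeg hnb
  rw [Fintype.card_fin, ← hi] at key
  have hWc := hW.card_le
  refine ⟨m, hmk, ?_⟩
  have hch : 2 * m.choose 2 = m * (m - 1) := by
    rw [Nat.choose_two_right, Nat.mul_div_cancel' (Nat.even_mul_pred_self m).two_dvd]
  rcases Nat.eq_or_lt_of_le him with rfl | hlt
  · have hW0 : W.card = 0 := by simpa using hWc
    rw [hW0] at key
    have e1 : i * (n - 1) + (n - i) * i = 2 * (i * (n - i)) + i * (i - 1) := by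
      obtain ⟨q, rfl⟩ : ∃ q, n = i + q := ⟨n - i, by omega⟩
      rw [Nat.add_sub_cancel_left]
      rcases i with _ | i
      · simp
      · rw [Nat.add_sub_cancel, show i + 1 + q - 1 = i + q by omega]; ring
    have e2 : (n - i) * (i + (d i - 1)) = (n - i) * i + (d i - 1) * (n - i) := by ring
    rw [e2] at key
    omega
  · have hWD : W.card ≤ D := by
      have : ∑ j ∈ Finset.Ico i m, (d j + 1) ≤ ∑ j ∈ range k, (d j + 1) :=
        Finset.sum_le_sum_of_subset (by intro x; simp; omega)
      omega
    have hkD : k ≤ D := by omega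
    have hdD : d m ≤ D := by
      have : d m + 1 ≤ ∑ j ∈ range k, (d j + 1) :=
        Finset.single_le_sum (f := fun j => d j + 1) (by simp) (Finset.mem_range.2 hmk)
      omega
    obtain ⟨q, hq⟩ : ∃ q, n = m + q := ⟨n - m, by omega⟩
    have hWD2 : W.card * D ≤ D * D := Nat.mul_le_mul_right _ hWD
    obtain ⟨r, hr⟩ : ∃ r, r = d m - 1 := ⟨_, rfl⟩
    rw [← hr] at key ⊢
    have hrD : r ≤ D := by omega
    have e1 : i * (n - 1) ≤ (m - 1) * n := Nat.mul_le_mul (by omega) (by omega)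
    have e2 : (n - i) * (i + r) ≤ n * (m - 1 + r) := Nat.mul_le_mul (by omega) (by omega)
    have e3 : n - m = q := by omega
    rw [e3]
    obtain ⟨p, rfl⟩ : ∃ p, m = p + 1 := ⟨m - 1, by omega⟩
    rw [Nat.add_sub_cancel] at e1 e2
    have hpD : p + 1 ≤ D := by omega
    have e4 : (p + 1) * (p + 1) ≤ D * D := Nat.mul_le_mul hpD hpD
    have e5 : r * (p + 1) ≤ D * D := Nat.mul_le_mul hrD hpD
    have e6 : 2 * G.edgeFinset.card ≤ 2 * ((p + 1) * q) + (p+1) * p + r * q - 1 := by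
      subst hq
      have : 2 * G.edgeFinset.card + 1 ≤ 2 * ((p + 1) * q) + (p+1) * p + r * q := by
        nlinarith
      omega
    rw [Nat.add_sub_cancel] at hch
    omega

/-- Jumps `2, …, h+1` and their negatives. -/
def jumps (N h : ℕ) : Finset (ZMod N) :=
  (Finset.Icc 2 (h + 1) ∪ Finset.Icc (N - h - 1) (N - 2)).image (fun x : ℕ => (x : ZMod N))

theorem mem_jumps {N h : ℕ} [NeZero N] (hN : 2 * h + 4 ≤ N) (x : ZMod N) :
    x ∈ jumps N h ↔ (2 ≤ x.val ∧ x.val ≤ h + 1) ∨ (N - h - 1 ≤ x.val ∧ x.val ≤ N - 2) := by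
  unfold jumps
  simp only [Finset.mem_image, Finset.mem_union, Finset.mem_Icc]
  constructor
  · rintro ⟨y, hy, rfl⟩
    rwa [ZMod.val_cast_of_lt (by omega)]
  · intro hx
    exact ⟨x.val, hx, ZMod.natCast_zmod_val x⟩

theorem card_jumps {N h : ℕ} [NeZero N] (hN : 2 * h + 4 ≤ N) : (jumps N h).card = 2 * h := by
  unfold jumps
  rw [Finset.card_image_of_injOn, Finset.card_union_of_disjoint]
  · simp only [Nat.card_Icc]; omega
  · rw [Finset.disjoint_left]; intro x; simp only [Finset.mem_Icc]; omega
  · intro x hx y hy hxy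
    simp only [Finset.coe_union, Finset.coe_Icc, Set.mem_union, Set.mem_Icc] at hx hy
    have := congrArg ZMod.val hxy
    dsimp only at this
    rwa [ZMod.val_cast_of_lt (by omega), ZMod.val_cast_of_lt (by omega)] at this

theorem neg_mem_jumps {N h : ℕ} [NeZero N] (hN : 2 * h + 4 ≤ N) {x : ZMod N}
    (hx : x ∈ jumps N h) : -x ∈ jumps N h := by
  rw [mem_jumps hN] at hx ⊢
  rw [ZMod.neg_val]
  have : x ≠ 0 := by rintro rfl; simp at hx; omega
  rw [if_neg this]
  omega

theorem pair_not_jump {N h : ℕ} [NeZero N] (hN : 2 * h + 4 ≤ N) {x y : ZMod N}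
    (hne : x ≠ y) (h2 : x.val / 2 = y.val / 2) : x - y ∉ jumps N h := by
  have h1 : (1 : ZMod N) ∉ jumps N h := by
    have : (1 : ZMod N).val = 1 := by
      have := ZMod.val_cast_of_lt (n := N) (a := 1) (by omega)
      simpa using this
    rw [mem_jumps hN, this]; omega
  have hv : x.val ≠ y.val := fun h => hne (ZMod.val_injective N h)
  rcases (by omega : x.val = y.val + 1 ∨ y.val = x.val + 1) with h | h
  · have : x = y + 1 := by
      rw [← ZMod.natCast_zmod_val x, h]; simp
    rw [this]; simpa using h1
  · have : y = x + 1 := by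
      rw [← ZMod.natCast_zmod_val y, h]; simp
    intro hm
    have := neg_mem_jumps hN hm
    simp_all

theorem exists_near_regular (r N : ℕ) (hN : r + 4 ≤ N) :
    ∃ (H : SimpleGraph (ZMod N)) (_ : Fintype (ZMod N)) (_ : DecidableRel H.Adj),
      (∀ v, H.degree v ≤ r) ∧ r * N / 2 ≤ H.edgeFinset.card := by
  classical
  have : NeZero N := ⟨by omega⟩
  obtain ⟨h, hh⟩ : ∃ h, h = r / 2 := ⟨_, rfl⟩
  have hN' : 2 * h + 4 ≤ N := by omega
  let H : SimpleGraph (ZMod N) :=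
    { Adj := fun x y => y - x ∈ jumps N h ∨ (r % 2 = 1 ∧ x ≠ y ∧ x.val / 2 = y.val / 2)
      symm := ⟨by
        rintro x y (hxy | ⟨h1, h2, h3⟩)
        · left; have := neg_mem_jumps hN' hxy; rwa [neg_sub] at this
        · exact Or.inr ⟨h1, h2.symm, h3.symm⟩⟩
      loopless := ⟨by
        rintro x (hx | hx)
        · rw [sub_self, mem_jumps hN', ZMod.val_zero] at hx; omega
        · exact hx.2.1 rfl⟩ }
  have hAdj : ∀ x y, H.Adj x y ↔
    (y - x ∈ jumps N h ∨ (r % 2 = 1 ∧ x ≠ y ∧ x.val / 2 = y.val / 2)) := fun _ _ => Iff.rfl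
  let A : ZMod N → Finset (ZMod N) := fun v => (jumps N h).image (fun s => v + s)
  have hA : ∀ v y, y ∈ A v ↔ y - v ∈ jumps N h := by
    intro v y
    simp only [A, Finset.mem_image]
    constructor
    · rintro ⟨s, hs, rfl⟩; simpa using hs
    · intro hy; exact ⟨y - v, hy, by ring⟩
  have hAc : ∀ v, (A v).card = 2 * h := by
    intro v
    rw [Finset.card_image_of_injective _ (add_right_injective v), card_jumps hN']
  let B : ZMod N → Finset (ZMod N) := fun v =>
    Finset.univ.filter fun y => r % 2 = 1 ∧ v ≠ y ∧ v.val / 2 = y.val / 2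
  have hdeg : ∀ v, H.degree v = 2 * h + (B v).card := by
    intro v
    rw [← hAc v, ← Finset.card_union_of_disjoint, ← H.card_neighborFinset_eq_degree]
    · congr 1
      ext y
      rw [H.mem_neighborFinset, hAdj, Finset.mem_union, hA]
      simp [B]
    · rw [Finset.disjoint_left]
      intro y hy hy'
      rw [hA] at hy
      simp only [B, Finset.mem_filter, Finset.mem_univ, true_and] at hy'
      exact pair_not_jump hN' hy'.2.1.symm hy'.2.2.symm hy
  have hBle : ∀ v, (B v).card ≤ r % 2 := by
    intro v
    rcases Nat.mod_two_eq_zero_or_one r with h0 | h1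
    · simp [B, h0]
    · rw [h1, Finset.card_le_one]
      intro x hx y hy
      simp only [B, Finset.mem_filter, Finset.mem_univ, true_and] at hx hy
      have e1 : v.val ≠ x.val := fun h => hx.2.1 (ZMod.val_injective N h)
      have e2 : v.val ≠ y.val := fun h => hy.2.1 (ZMod.val_injective N h)
      exact ZMod.val_injective N (by omega)
  have hBge : ∀ v : ZMod N, v.val + 1 < N → r % 2 ≤ (B v).card := by
    intro v hv
    rcases Nat.mod_two_eq_zero_or_one r with h0 | h1
    · omega
    · rw [h1, Nat.one_le_iff_ne_zero, ← Nat.pos_iff_ne_zero, Finset.card_pos]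
      have hp : ((2 * (v.val / 2) + (1 - v.val % 2) : ℕ) : ZMod N).val
          = 2 * (v.val / 2) + (1 - v.val % 2) := ZMod.val_cast_of_lt (by omega)
      refine ⟨((2 * (v.val / 2) + (1 - v.val % 2) : ℕ) : ZMod N), ?_⟩
      simp only [B, Finset.mem_filter, Finset.mem_univ, true_and]
      refine ⟨h1, ?_, by rw [hp]; omega⟩
      intro hc
      have := congrArg ZMod.val hc
      rw [hp] at this
      omega
  refine ⟨H, inferInstance, inferInstance, fun v => ?_, ?_⟩
  · rw [hdeg]; have := hBle v; omega
  · have hs := H.sum_degrees_eq_twice_card_edges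
    have hl : ∀ v : ZMod N, (if v = ((N - 1 : ℕ) : ZMod N) then r - 1 else r) ≤ H.degree v := by
      intro v
      rw [hdeg]
      split_ifs with hv
      · omega
      · have := hBge v (by
          have h1 := ZMod.val_lt v
          by_contra! h2
          apply hv
          rw [← ZMod.natCast_zmod_val v]
          congr 1
          omega)
        omega
    have hl2 := Finset.sum_le_sum (s := Finset.univ) fun v _ => hl v
    rw [hs, ← Finset.add_sum_erase _ _ (Finset.mem_univ ((N - 1 : ℕ) : ZMod N)), if_pos rfl,
      Finset.sum_congr rfl (fun v hv => if_neg (Finset.ne_of_mem_erase hv)), Finset.sum_const,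
      Finset.card_erase_of_mem (Finset.mem_univ _), Finset.card_univ, ZMod.card, smul_eq_mul] at hl2
    obtain ⟨q, rfl⟩ : ∃ q, N = q + 1 := ⟨N - 1, by omega⟩
    rw [Nat.add_sub_cancel] at hl2
    have : r * (q + 1) = q * r + r := by ring
    omega

/-- Join of a complete graph on `i` vertices with `H`. -/
def joinComplete (i : ℕ) {B : Type*} (H : SimpleGraph B) : SimpleGraph (Fin i ⊕ B) :=
  SimpleGraph.fromRel fun x y => match x, y with
    | Sum.inr u, Sum.inr v => H.Adj u v
    | _, _ => True

theorem joinComplete_inr (i : ℕ) {B : Type*} (H : SimpleGraph B) (u v : B) :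
    (joinComplete i H).Adj (Sum.inr u) (Sum.inr v) ↔ H.Adj u v := by
  simp only [joinComplete, SimpleGraph.fromRel_adj, ne_eq, Sum.inr.injEq]
  constructor
  · rintro ⟨-, h | h⟩
    exacts [h, h.symm]
  · intro h; exact ⟨h.ne, Or.inl h⟩

theorem joinComplete_edges (i : ℕ) {B : Type*} [Fintype B] [DecidableEq B] (H : SimpleGraph B)
    [DecidableRel H.Adj] [DecidableRel (joinComplete i H).Adj] :
    i * Fintype.card B + i.choose 2 + H.edgeFinset.card ≤ (joinComplete i H).edgeFinset.card := by
  have h1 : ∀ u, (i - 1) + Fintype.card B ≤ (joinComplete i H).degree (Sum.inl u) := by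
    intro u
    have : ((Finset.univ.erase u).disjSum (Finset.univ : Finset B)).card
      = (i - 1) + Fintype.card B := by
      rw [Finset.card_disjSum, Finset.card_erase_of_mem (Finset.mem_univ _)]; simp
    rw [← this, ← SimpleGraph.card_neighborFinset_eq_degree]
    refine Finset.card_le_card ?_
    rintro (x | x) hx
    · simp at hx
      rw [SimpleGraph.mem_neighborFinset]
      simp [joinComplete, Ne.symm hx]
    · rw [SimpleGraph.mem_neighborFinset]
      simp [joinComplete]
  have h2 : ∀ v, i + H.degree v ≤ (joinComplete i H).degree (Sum.inr v) := by
    intro v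
    have : ((Finset.univ : Finset (Fin i)).disjSum (H.neighborFinset v)).card
      = i + H.degree v := by
      rw [Finset.card_disjSum]; simp
    rw [← this, ← SimpleGraph.card_neighborFinset_eq_degree]
    refine Finset.card_le_card ?_
    rintro (x | x) hx
    · rw [SimpleGraph.mem_neighborFinset]
      simp [joinComplete]
    · simp at hx
      rw [SimpleGraph.mem_neighborFinset, joinComplete_inr]
      exact hx
  have hs := (joinComplete i H).sum_degrees_eq_twice_card_edges
  have hH := H.sum_degrees_eq_twice_card_edges
  rw [Fintype.sum_sum_type] at hs
  have h3 := Finset.sum_le_sum (s := Finset.univ) fun v _ => h1 v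
  have h4 := Finset.sum_le_sum (s := Finset.univ) fun v _ => h2 v
  rw [Finset.sum_add_distrib, hH] at h4
  simp only [Finset.sum_const, Finset.card_univ, smul_eq_mul, Fintype.card_fin] at h3 h4
  have hch : 2 * i.choose 2 = i * (i - 1) := by
    rw [Nat.choose_two_right, Nat.mul_div_cancel' (Nat.even_mul_pred_self i).two_dvd]
  rw [Nat.mul_add] at h3
  rw [Nat.mul_comm] at h4
  omega

theorem joinComplete_free {k : ℕ} (a : Fin k → ℕ) (ha : Monotone a) (ha1 : ∀ i, 1 ≤ a i)
    (i : Fin k) {B : Type*} [Fintype B] (H : SimpleGraph B) [DecidableRel H.Adj]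
    (hH : ∀ v, H.degree v ≤ a i.rev - 1) : ¬ Contains (starForest a) (joinComplete i H) := by
  classical
  rintro ⟨f, hf⟩
  have hex : ∃ j ∈ Finset.Ici i.rev, ∀ x : Fin (a j + 1), ∃ v, f ⟨j, x⟩ = Sum.inr v := by
    by_contra! hcon
    have h1 : ∀ j : Fin k, ∃ u : Fin (i : ℕ), j ∈ Finset.Ici i.rev →
        ∃ x : Fin (a j + 1), f ⟨j, x⟩ = Sum.inl u := by
      intro j
      by_cases hj : j ∈ Finset.Ici i.rev
      · obtain ⟨x, hx⟩ := hcon j hj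
        rcases hfx : f ⟨j, x⟩ with u | v
        · exact ⟨u, fun _ => ⟨x, hfx⟩⟩
        · exact absurd hfx (hx v)
      · obtain ⟨x, hx⟩ := hcon i.rev (by simp)
        rcases hfx : f ⟨i.rev, x⟩ with u | v
        · exact ⟨u, fun h => absurd h hj⟩
        · exact absurd hfx (hx v)
    choose g hg using h1
    have hcard : (Finset.univ : Finset (Fin (i : ℕ))).card < (Finset.Ici i.rev).card := by
      rw [Fin.card_Ici]; simp [Fin.val_rev]; omega
    obtain ⟨j, hj, j', hj', hne, heq⟩ :=
      Finset.exists_ne_map_eq_of_card_lt_of_maps_to hcard (f := g) (fun _ _ => by simp)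
    obtain ⟨x, hx⟩ := hg j hj
    obtain ⟨x', hx'⟩ := hg j' hj'
    have := f.injective (hx.trans ((congrArg Sum.inl heq).trans hx'.symm))
    exact hne (congrArg Sigma.fst this)
  obtain ⟨j, hj, hx⟩ := hex
  choose v hv using hx
  have hadj : ∀ y : Fin (a j), H.Adj (v 0) (v y.succ) := by
    intro y
    rw [← joinComplete_inr i, ← hv, ← hv]
    apply hf
    rw [starForest, SimpleGraph.fromRel_adj]
    refine ⟨?_, Or.inl ⟨rfl, rfl⟩⟩
    intro h
    have := eq_of_heq (Sigma.mk.inj h).2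
    exact (Fin.succ_ne_zero y) this.symm
  have hinj : Function.Injective fun y : Fin (a j) => v y.succ := by
    intro y y' h
    have h2 : f ⟨j, y.succ⟩ = f ⟨j, y'.succ⟩ := by rw [hv, hv]; exact congrArg _ h
    have h3 := eq_of_heq (Sigma.mk.inj (f.injective h2)).2
    exact Fin.succ_injective _ h3
  have hle : a j ≤ H.degree (v 0) := by
    have : (Finset.univ.image fun y : Fin (a j) => v y.succ).card = a j := by
      rw [Finset.card_image_of_injective _ hinj]; simp
    rw [← SimpleGraph.card_neighborFinset_eq_degree]
    refine this.ge.trans (Finset.card_le_card ?_)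
    intro x hx
    obtain ⟨y, -, rfl⟩ := Finset.mem_image.1 hx
    rw [SimpleGraph.mem_neighborFinset]
    exact hadj y
  have h1 := hH (v 0)
  have h2 := ha (Finset.mem_Ici.1 hj)
  have h3 := ha1 i.rev
  omega

theorem lower_bound {k : ℕ} (a : Fin k → ℕ) (ha : Monotone a) (ha1 : ∀ i, 1 ≤ a i)
    (i : Fin k) (n : ℕ) (hn : a i.rev + i + 4 ≤ n) :
    ∃ G : SimpleGraph (Fin n), ¬ Contains (starForest a) G ∧
      (i : ℕ) * (n - i) + Nat.choose i 2 + (a i.rev - 1) * (n - (i : ℕ)) / 2 ≤ G.edgeSet.ncard := by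
  classical
  obtain ⟨H, hF, hD, h1, h2⟩ := exists_near_regular (a i.rev - 1) (n - i) (by omega)
  have hc : Fintype.card (Fin i ⊕ ZMod (n - i)) = n := by
    have : NeZero (n - (i : ℕ)) := ⟨by omega⟩
    rw [Fintype.card_sum, Fintype.card_fin, ZMod.card]; omega
  have hc2 : Fintype.card (ZMod (n - i)) = n - i := ZMod.card _
  let e : Fin i ⊕ ZMod (n - i) ≃ Fin n := Fintype.equivFinOfCardEq hc
  refine ⟨(joinComplete i H).map e.toEmbedding, ?_, ?_⟩
  · rintro ⟨f, hf⟩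
    refine joinComplete_free a ha ha1 i H h1 ⟨f.trans e.symm.toEmbedding, ?_⟩
    intro x y hxy
    have := hf hxy
    rw [SimpleGraph.map_adj] at this
    obtain ⟨u, v, huv, hu, hv⟩ := this
    simp only [Function.Embedding.trans_apply, ← hu, ← hv]
    simpa using huv
  · have h3 := joinComplete_edges i H
    rw [hc2] at h3
    have h4 : ((joinComplete i H).map e.toEmbedding).edgeSet.ncard
        = (joinComplete i H).edgeFinset.card := by
      rw [SimpleGraph.edgeSet_map, Set.ncard_image_of_injective _ (Function.Embedding.injective _),
        ← SimpleGraph.coe_edgeFinset, Set.ncard_coe_finset]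
    omega

/-- Lidický–Liu–Palmer: if `F` is a forest of `k` stars with `a 0 ≤ a 1 ≤ … ≤ a (k-1)` edges
(each star having at least one edge), then for all sufficiently large `n`,
`ex(n, F) = max_{0 ≤ i ≤ k-1} { i(n-i) + C(i,2) + ⌊(a_{k-i} - 1)(n-i)/2⌋ }`,
where `a_{k-i}` is the `(k-i)`-th smallest star size, i.e. `a i.rev`. -/
theorem turan_starForest {k : ℕ} (hk : 0 < k)
    (a : Fin k → ℕ) (ha : Monotone a) (ha1 : ∀ i, 1 ≤ a i) :
    ∃ N : ℕ, ∀ n ≥ N,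
      IsGreatest (exSet n (starForest a))
        (Finset.univ.sup fun i : Fin k =>
          (i : ℕ) * (n - i) + Nat.choose i 2 + (a i.rev - 1) * (n - (i : ℕ)) / 2) := by
  classical
  let d : ℕ → ℕ := fun j => if h : j < k then a (Fin.rev ⟨j, h⟩) else 0
  have hd : ∀ i : Fin k, d i = a i.rev := fun i => by simp [d]
  obtain ⟨N, hN⟩ := upper_bound_s6 a d (fun j => by rw [hd, Fin.rev_rev])
  refine ⟨N + ∑ i, a i + k + 4, fun n hn => ?_⟩
  have hub : ∀ G : SimpleGraph (Fin n), ¬ Contains (starForest a) G →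
      G.edgeSet.ncard ≤ Finset.univ.sup fun i : Fin k =>
          (i : ℕ) * (n - i) + Nat.choose i 2 + (a i.rev - 1) * (n - (i : ℕ)) / 2 := by
    intro G hG
    obtain ⟨m, hm, hle⟩ := hN n (by omega) G hG
    rw [← SimpleGraph.coe_edgeFinset, Set.ncard_coe_finset]
    refine hle.trans ?_
    have := Finset.le_sup (f := fun i : Fin k =>
          (i : ℕ) * (n - i) + Nat.choose i 2 + (a i.rev - 1) * (n - (i : ℕ)) / 2)
          (Finset.mem_univ ⟨m, hm⟩)
    have h2 := hd ⟨m, hm⟩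
    dsimp only at h2
    rw [h2]
    exact this
  constructor
  · have : Nonempty (Fin k) := ⟨⟨0, hk⟩⟩
    obtain ⟨i, -, hi⟩ := Finset.exists_mem_eq_sup (Finset.univ : Finset (Fin k))
      Finset.univ_nonempty (fun i : Fin k =>
          (i : ℕ) * (n - i) + Nat.choose i 2 + (a i.rev - 1) * (n - (i : ℕ)) / 2)
    have h1 : a i.rev ≤ ∑ i, a i := Finset.single_le_sum (by simp) (Finset.mem_univ i.rev)
    obtain ⟨G, hG, hle⟩ := lower_bound a ha ha1 i n (by omega)
    exact ⟨G, hG, le_antisymm (hub G hG) (hi.le.trans hle)⟩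
  · rintro m ⟨G, hG, rfl⟩
    exact hub G hG
end

section
/- Every graph on n vertices with more than 2n edges, equipped with any proper edge-coloring, contains a rainbow path with 4 edges. -/
open SimpleGraph Finset

lemma path5_edge (e : Sym2 (Fin 5)) (he : e ∈ (pathGraph 5).edgeSet) :
    e = s(0,1) ∨ e = s(1,2) ∨ e = s(2,3) ∨ e = s(3,4) := by
  induction e with | _ i j
  rw [mem_edgeSet, pathGraph_adj] at he
  revert i j
  decide

lemma rainbow_of_path {V β : Type*} {G : SimpleGraph V} {c : Sym2 V → β}
    (hc : IsProperEdgeColoring G c) {x₀ x₁ x₂ x₃ x₄ : V}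
    (h01 : G.Adj x₀ x₁) (h12 : G.Adj x₁ x₂) (h23 : G.Adj x₂ x₃) (h34 : G.Adj x₃ x₄)
    (n02 : x₀ ≠ x₂) (n03 : x₀ ≠ x₃) (n04 : x₀ ≠ x₄) (n13 : x₁ ≠ x₃) (n14 : x₁ ≠ x₄)
    (n24 : x₂ ≠ x₄)
    (c02 : c s(x₀, x₁) ≠ c s(x₂, x₃)) (c03 : c s(x₀, x₁) ≠ c s(x₃, x₄))
    (c13 : c s(x₁, x₂) ≠ c s(x₃, x₄)) : HasRainbowCopy (pathGraph 5) G c := by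
  have key : ∀ {a b d : V}, G.Adj a b → G.Adj b d → a ≠ d → c s(a, b) ≠ c s(b, d) := by
    intro a b d hab hbd had
    refine hc (by simpa using hab) (by simpa using hbd) ?_ ⟨b, by simp, by simp⟩
    intro h
    rw [Sym2.eq_iff] at h
    rcases h with ⟨h1, h2⟩ | ⟨h1, h2⟩
    · exact hab.ne h1
    · exact had h1
  have c01 := key h01 h12 n02
  have c12 := key h12 h23 n13
  have c23 := key h23 h34 n24
  have m01 := h01.ne
  have m12 := h12.ne
  have m23 := h23.ne
  have m34 := h34.ne
  refine ⟨⟨![x₀, x₁, x₂, x₃, x₄], ?_⟩, ?_, ?_⟩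
  · intro i j hij
    fin_cases i <;> fin_cases j <;> simp_all
  · intro a b hab
    have := path5_edge s(a, b) hab
    simp only [Sym2.eq_iff] at this
    rcases this with (⟨rfl, rfl⟩ | ⟨rfl, rfl⟩) | (⟨rfl, rfl⟩ | ⟨rfl, rfl⟩) |
      (⟨rfl, rfl⟩ | ⟨rfl, rfl⟩) | (⟨rfl, rfl⟩ | ⟨rfl, rfl⟩) <;>
    first | exact h01 | exact h12 | exact h23 | exact h34 | exact h01.symm | exact h12.symm
          | exact h23.symm | exact h34.symm
  · intro e₁ he₁ e₂ he₂ h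
    rcases path5_edge e₁ he₁ with rfl | rfl | rfl | rfl <;>
    rcases path5_edge e₂ he₂ with rfl | rfl | rfl | rfl <;>
    first | rfl | (exfalso; first | exact c01 h | exact c02 h | exact c03 h | exact c12 h | exact c13 h | exact c23 h | exact c01 h.symm | exact c02 h.symm | exact c03 h.symm | exact c12 h.symm | exact c13 h.symm | exact c23 h.symm)

lemma exists_other {V : Type*} [DecidableEq V] (s t : Finset V) (h : #t < #s) :
    ∃ x ∈ s, x ∉ t := by
  by_contra! hh
  exact absurd (card_le_card hh) (by omega)

open Classical in
lemma core {V β : Type*} {G : SimpleGraph V} {c : Sym2 V → β}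
    (hc : IsProperEdgeColoring G c) (S : Finset V)
    (hS : ∀ x ∈ S, 3 ≤ #(S.filter (G.Adj x))) (v : V) (hv : v ∈ S)
    (hd : 5 ≤ #(S.filter (G.Adj v))) : HasRainbowCopy (pathGraph 5) G c := by
  have key : ∀ {b a d : V}, G.Adj b a → G.Adj b d → a ≠ d → c s(b, a) ≠ c s(b, d) := by
    intro b a d hab hbd had
    refine hc (by simpa using hab) (by simpa using hbd) ?_ ⟨b, by simp, by simp⟩
    intro h
    rw [Sym2.eq_iff] at h
    rcases h with ⟨h1, h2⟩ | ⟨h1, h2⟩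
    · exact had h2
    · exact hab.ne h2.symm
  set N := S.filter (G.Adj v) with hN
  have memN : ∀ x, x ∈ N ↔ x ∈ S ∧ G.Adj v x := by intro x; simp [hN]
  by_cases hclosed : ∀ u ∈ N, ∀ w ∈ S, G.Adj u w → w ≠ v → w ∈ N
  · by_contra hno
    -- each vertex of `N` has a neighbour in `N` avoiding any given vertex
    have nb : ∀ u ∈ N, ∀ y, ∃ z ∈ N, G.Adj u z ∧ z ≠ y := by
      intro u hu y
      obtain ⟨z, hz, hz'⟩ := exists_other (S.filter (G.Adj u)) {v, y}
        (lt_of_le_of_lt card_le_two (hS u ((memN u).1 hu).1))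
      simp only [mem_filter, mem_insert, mem_singleton, not_or] at hz hz'
      exact ⟨z, hclosed u hu z hz.1 hz.2 hz'.1, hz.2, hz'.2⟩
    have M0 : ∀ a ∈ N, ∀ a' ∈ N, ∀ b ∈ N, ∀ b' ∈ N, G.Adj a a' → G.Adj b b' → a ≠ b → a ≠ b' →
        a' ≠ b → a' ≠ b' → c s(a, a') = c s(b, b') ∨ c s(a, a') = c s(v, b) ∨
          c s(b, b') = c s(v, a) := by
      intro a ha a' ha' b hb b' hb' haa hbb h1 h2 h3 h4
      by_contra! hcon
      obtain ⟨k1, k2, k3⟩ := hcon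
      rw [memN] at ha ha' hb hb'
      apply hno
      refine rainbow_of_path hc haa.symm ha.2.symm hb.2 hbb ha'.2.ne' h3 h4 h1 h2 hb'.2.ne
        ?_ ?_ ?_
      · rwa [Sym2.eq_swap]
      · rwa [Sym2.eq_swap]
      · rw [Sym2.eq_swap]; exact k3.symm
    have M : ∀ a ∈ N, ∀ a' ∈ N, ∀ b ∈ N, ∀ b' ∈ N, G.Adj a a' → G.Adj b b' → a ≠ b → a ≠ b' →
        a' ≠ b → a' ≠ b' → c s(a, a') = c s(b, b') := by
      intro a ha a' ha' b hb b' hb' haa hbb h1 h2 h3 h4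
      have q1 := M0 a ha a' ha' b hb b' hb' haa hbb h1 h2 h3 h4
      have q2 := M0 a' ha' a ha b hb b' hb' haa.symm hbb h3 h4 h1 h2
      have q3 := M0 a ha a' ha' b' hb' b hb haa hbb.symm h2 h1 h4 h3
      have q4 := M0 a' ha' a ha b' hb' b hb haa.symm hbb.symm h4 h3 h2 h1
      rw [Sym2.eq_swap (a := a') (b := a)] at q2 q4
      rw [Sym2.eq_swap (a := b') (b := b)] at q3 q4
      have r1 := key ((memN a).1 ha).2 ((memN a').1 ha').2 haa.ne
      have r2 := key ((memN b).1 hb).2 ((memN b').1 hb').2 hbb.ne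
      grind
    -- no path of length two with a disjoint edge
    have L : ∀ f ∈ N, ∀ a ∈ N, ∀ b ∈ N, ∀ x ∈ N, ∀ y ∈ N, G.Adj a f → G.Adj a b → f ≠ b →
        G.Adj x y → x ≠ f → x ≠ a → x ≠ b → y ≠ f → y ≠ a → y ≠ b → False := by
      intro f hf a ha b hb x hx y hy haf hab hfb hxy h1 h2 h3 h4 h5 h6
      have e1 := M a ha f hf x hx y hy haf hxy h2.symm h5.symm h1.symm h4.symm
      have e2 := M a ha b hb x hx y hy hab hxy h2.symm h5.symm h3.symm h6.symm
      exact key haf hab hfb (e1.trans e2.symm)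
    -- two disjoint edges
    have D : ∃ a ∈ N, ∃ b ∈ N, ∃ x ∈ N, ∃ y ∈ N, G.Adj a b ∧ G.Adj x y ∧ a ≠ x ∧ a ≠ y ∧
        b ≠ x ∧ b ≠ y := by
      obtain ⟨a, ha⟩ : N.Nonempty := card_pos.1 (by omega)
      obtain ⟨b, hb, hab, -⟩ := nb a ha a
      obtain ⟨d, hd', had, hdb⟩ := nb a ha b
      obtain ⟨e, he, he'⟩ := exists_other N {a, b, d} (lt_of_le_of_lt card_le_three (by omega))
      simp only [mem_insert, mem_singleton, not_or] at he'
      obtain ⟨y, hy, hey, hya⟩ := nb e he a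
      by_cases hyb : y = b
      · subst hyb
        exact ⟨a, ha, d, hd', e, he, y, hy, had, hey, by grind⟩
      · exact ⟨a, ha, b, hb, e, he, y, hy, hab, hey, by grind⟩
    obtain ⟨a, ha, b, hb, x, hx, y, hy, hab, hxy, n1, n2, n3, n4⟩ := D
    obtain ⟨f, hf, hf'⟩ := exists_other N {a, b, x, y} (lt_of_le_of_lt card_le_four (by omega))
    simp only [mem_insert, mem_singleton, not_or] at hf'
    obtain ⟨f1, f2, f3, f4⟩ := hf'
    have A : ∀ g ∈ N, G.Adj f g → g ≠ a ∧ g ≠ b ∧ g ≠ x ∧ g ≠ y := by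
      intro g hg hfg
      refine ⟨?_, ?_, ?_, ?_⟩ <;> rintro rfl
      · exact L f hf g hg b hb x hx y hy hfg.symm hab f2 hxy (Ne.symm f3) n1.symm n3.symm
          (Ne.symm f4) n2.symm n4.symm
      · exact L f hf g hg a ha x hx y hy hfg.symm hab.symm f1 hxy (Ne.symm f3) n3.symm n1.symm
          (Ne.symm f4) n4.symm n2.symm
      · exact L f hf g hg y hy a ha b hb hfg.symm hxy f4 hab (Ne.symm f1) n1 n2
          (Ne.symm f2) n3 n4
      · exact L f hf g hg x hx a ha b hb hfg.symm hxy.symm f3 hab (Ne.symm f1) n2 n1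
          (Ne.symm f2) n4 n3
    obtain ⟨g, hg, hfg, -⟩ := nb f hf f
    obtain ⟨g', hg', hfg', hgg⟩ := nb f hf g
    obtain ⟨p1, p2, p3, p4⟩ := A g hg hfg
    obtain ⟨p1', p2', p3', p4'⟩ := A g' hg' hfg'
    exact L g hg f hf g' hg' a ha b hb hfg hfg' hgg.symm hab p1.symm (Ne.symm f1) p1'.symm
      p2.symm (Ne.symm f2) p2'.symm
  · push Not at hclosed
    obtain ⟨u, hu, w, hw, huw, hwv, hwN⟩ := hclosed
    have hu' := (memN u).1 hu
    have hvw : ¬ G.Adj v w := fun h => hwN ((memN w).2 ⟨hw, h⟩)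
    obtain ⟨x, hx, hxu, hxc⟩ : ∃ x, G.Adj w x ∧ x ≠ u ∧ c s(w, x) ≠ c s(v, u) := by
      obtain ⟨z, hz, hz'⟩ := exists_other (S.filter (G.Adj w)) {u}
        (by have := hS w hw; rw [card_singleton]; omega)
      obtain ⟨z2, hz2, hz2'⟩ := exists_other (S.filter (G.Adj w)) {u, z}
        (lt_of_le_of_lt card_le_two (hS w hw))
      simp only [mem_filter, mem_insert, mem_singleton, not_or] at hz hz' hz2 hz2'
      by_cases hcz : c s(w, z) = c s(v, u)
      · refine ⟨z2, hz2.2, hz2'.1, fun h => ?_⟩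
        exact key hz2.2 hz.2 hz2'.2 (h.trans hcz.symm)
      · exact ⟨z, hz.2, hz', hcz⟩
    have hxv : x ≠ v := by rintro rfl; exact hvw hx.symm
    -- at most one neighbour of `v` per colour
    have one : ∀ k : β, ∃ y : V, ∀ z, G.Adj v z → c s(v, z) = k → z = y := by
      intro k
      by_cases hk : ∃ y, G.Adj v y ∧ c s(v, y) = k
      · obtain ⟨y, hy, hyk⟩ := hk
        refine ⟨y, fun z hz hzk => ?_⟩
        by_contra hne
        exact key hz hy hne (hzk.trans hyk.symm)
      · exact ⟨v, fun z hz hzk => absurd ⟨z, hz, hzk⟩ hk⟩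
    obtain ⟨y1, hy1⟩ := one (c s(u, w))
    obtain ⟨y2, hy2⟩ := one (c s(w, x))
    obtain ⟨t, ht, ht'⟩ := exists_other N {u, x, y1, y2} (lt_of_le_of_lt card_le_four (by omega))
    simp only [mem_insert, mem_singleton, not_or] at ht'
    have htv := ((memN t).1 ht).2
    refine rainbow_of_path hc htv.symm hu'.2 huw hx ht'.1 (by rintro rfl; exact hvw htv) ht'.2.1
      hwv.symm hxv.symm hxu.symm ?_ ?_ hxc.symm
    · rw [Sym2.eq_swap]; exact fun h => ht'.2.2.1 (hy1 t htv h)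
    · rw [Sym2.eq_swap]; exact fun h => ht'.2.2.2 (hy2 t htv h)

open Classical in
lemma main_induct {V β : Type*} {G : SimpleGraph V} {c : Sym2 V → β}
    (hc : IsProperEdgeColoring G c) (S : Finset V) :
    4 * #S < ∑ x ∈ S, #(S.filter (G.Adj x)) → HasRainbowCopy (pathGraph 5) G c := by
  induction S using Finset.strongInduction with
  | H S ih =>
    intro h
    by_cases hS : ∀ x ∈ S, 3 ≤ #(S.filter (G.Adj x))
    · obtain ⟨v, hv, hd⟩ : ∃ v ∈ S, 5 ≤ #(S.filter (G.Adj v)) := by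
        by_contra! hh
        have : ∑ x ∈ S, #(S.filter (G.Adj x)) ≤ ∑ x ∈ S, 4 :=
          sum_le_sum fun x hx => Nat.le_of_lt_succ (hh x hx)
        rw [sum_const, smul_eq_mul] at this
        omega
      exact core hc S hS v hv hd
    · push Not at hS
      obtain ⟨v, hv, hd⟩ := hS
      refine ih (S.erase v) (erase_ssubset hv) ?_
      have e1 : ∀ x, #(S.filter (G.Adj x)) =
          #((S.erase v).filter (G.Adj x)) + if G.Adj x v then 1 else 0 := by
        intro x
        rw [filter_erase]
        split_ifs with hx
        · rw [card_erase_add_one (by simp [hv, hx])]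
        · rw [erase_eq_of_notMem (by simp [hx])]; rfl
      have e2 : ∑ x ∈ S, #(S.filter (G.Adj x)) =
          ∑ x ∈ S.erase v, #(S.filter (G.Adj x)) + #(S.filter (G.Adj v)) :=
        (sum_erase_add _ _ hv).symm
      have e3 : ∑ x ∈ S.erase v, #(S.filter (G.Adj x)) =
          ∑ x ∈ S.erase v, #((S.erase v).filter (G.Adj x)) +
            #((S.erase v).filter (fun x => G.Adj x v)) := by
        rw [card_filter, ← sum_add_distrib]
        exact sum_congr rfl fun x _ => e1 x
      have e4 : #((S.erase v).filter (fun x => G.Adj x v)) ≤ #(S.filter (G.Adj v)) := by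
        apply card_le_card
        intro x hx
        simp only [mem_filter, mem_erase] at hx ⊢
        exact ⟨hx.1.2, hx.2.symm⟩
      have e5 := card_erase_add_one hv
      omega

/-- Every properly edge-colored graph on `n` vertices with more than `2n` edges
contains a rainbow path with `4` edges. -/
theorem rainbow_P4_of_many_edges {n : ℕ} (G : SimpleGraph (Fin n))
    (h : 2 * n < G.edgeSet.ncard) {β : Type*} (c : Sym2 (Fin n) → β)
    (hc : IsProperEdgeColoring G c) :
    HasRainbowCopy (pathGraph 5) G c := by
  classical
  apply main_induct hc Finset.univ
  have h1 := G.sum_degrees_eq_twice_card_edges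
  have h2 : G.edgeSet.ncard = #G.edgeFinset := by
    rw [← coe_edgeFinset, Set.ncard_coe_finset]
  have h3 : ∑ x, #(Finset.univ.filter (G.Adj x)) = ∑ x, G.degree x := by
    refine sum_congr rfl fun x _ => ?_
    rw [← card_neighborFinset_eq_degree, neighborFinset_eq_filter]
  have h4 : #(Finset.univ : Finset (Fin n)) = n := by simp
  have h5 : ∑ x, #(Finset.univ.filter (G.Adj x)) = 2 * G.edgeSet.ncard := by
    rw [h3, h1, h2]
  have h6 : 4 * #(Finset.univ : Finset (Fin n)) < 2 * G.edgeSet.ncard := by omega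
  rw [← h5] at h6
  convert h6
end

section
/- If n is divisible by 8, then ex*(n, P_4) = 2n; that is, the maximum number of edges in an n-vertex graph admitting a proper edge-coloring with no rainbow path of 4 edges equals 2n, achieved by a disjoint union of n/8 suitably properly edge-colored copies of K_{4,4}. In general, ex*(n, P_4) = 2n + O(1). This disproves the conjecture of Keevash, Mubayi, Sudakov and Verstraëte, which would imply ex*(n, P_4) = (3/2)n + O(1). -/
open SimpleGraph Finset

theorem rainbow_of_path_s16 {V : Type*} {G : SimpleGraph V} {c : Sym2 V → ℕ}
    (hp : ∀ a b d, G.Adj a b → G.Adj a d → b ≠ d → c s(a, b) ≠ c s(a, d))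
    (hno : ¬ HasRainbowCopy (pathGraph 5) G c)
    {p q r s t : V} (h1 : G.Adj p q) (h2 : G.Adj q r) (h3 : G.Adj r s) (h4 : G.Adj s t)
    (hpr : p ≠ r) (hps : p ≠ s) (hpt : p ≠ t) (hqs : q ≠ s) (hqt : q ≠ t) (hrt : r ≠ t)
    (c13 : c s(p, q) ≠ c s(r, s)) (c14 : c s(p, q) ≠ c s(s, t))
    (c24 : c s(q, r) ≠ c s(s, t)) : False := by
  have c12 : c s(p, q) ≠ c s(q, r) := by
    rw [Sym2.eq_swap]; exact hp _ _ _ h1.symm h2 hpr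
  have c23 : c s(q, r) ≠ c s(r, s) := by
    rw [Sym2.eq_swap]; exact hp _ _ _ h2.symm h3 hqs
  have c34 : c s(r, s) ≠ c s(s, t) := by
    rw [Sym2.eq_swap]; exact hp _ _ _ h3.symm h4 hrt
  have n1 := h1.ne
  have n2 := h2.ne
  have n3 := h3.ne
  have n4 := h4.ne
  apply hno
  have hinj : Function.Injective ![p, q, r, s, t] := by
    intro a b hab
    fin_cases a <;> fin_cases b <;> simp_all
  have hedge : ∀ e ∈ (pathGraph 5).edgeSet,
      e = s(0, 1) ∨ e = s(1, 2) ∨ e = s(2, 3) ∨ e = s(3, 4) := by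
    intro e
    induction e using Sym2.ind with
    | _ a b =>
      rw [mem_edgeSet, pathGraph_adj]
      revert a b
      decide
  refine ⟨⟨_, hinj⟩, ?_, ?_⟩
  · intro a b hab
    rcases hedge s(a, b) hab with h | h | h | h <;>
    · rw [Sym2.eq_iff] at h
      rcases h with ⟨rfl, rfl⟩ | ⟨rfl, rfl⟩ <;> simp [*, G.adj_comm]
  · intro e he ee he' h
    rcases hedge e he with rfl | rfl | rfl | rfl <;>
    rcases hedge ee he' with rfl | rfl | rfl | rfl <;>
    first
    | rfl
    | (exfalso
       simp only [Sym2.map_mk, Function.Embedding.coeFn_mk] at h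
       first
       | exact c12 h | exact c13 h | exact c14 h | exact c23 h | exact c24 h | exact c34 h
       | exact c12 h.symm | exact c13 h.symm | exact c14 h.symm | exact c23 h.symm
       | exact c24 h.symm | exact c34 h.symm)

open Classical in
theorem deg_le_four {V : Type*} {G : SimpleGraph V} {c : Sym2 V → ℕ}
    (hp : ∀ a b d, G.Adj a b → G.Adj a d → b ≠ d → c s(a, b) ≠ c s(a, d))
    (hno : ¬ HasRainbowCopy (pathGraph 5) G c) (S : Finset V)
    (hdeg : ∀ v ∈ S, 3 ≤ (S.filter (G.Adj v)).card) (v : V) (hv : v ∈ S) :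
    (S.filter (G.Adj v)).card ≤ 4 := by
  by_contra! hlt
  have avoid : ∀ (A T : Finset V), T.card < A.card → ∃ x ∈ A, x ∉ T := fun A T h =>
    Finset.exists_mem_notMem_of_card_lt_card h
  -- at most one neighbour of a given colour
  have colset : ∀ (a : V) (k : ℕ), ∃ T : Finset V, T.card ≤ 1 ∧
      ∀ b, G.Adj a b → c s(a, b) = k → b ∈ T := by
    intro a k
    by_cases h : ∃ b, G.Adj a b ∧ c s(a, b) = k
    · obtain ⟨b, hb, hk⟩ := h
      refine ⟨{b}, by simp, fun d hd hk' => ?_⟩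
      by_contra hne
      rw [Finset.mem_singleton] at hne
      exact hp a d b hd hb hne (hk'.trans hk.symm)
    · exact ⟨∅, by simp, fun b hb hk => absurd ⟨b, hb, hk⟩ h⟩
  -- closure
  have closed : ∀ u w, G.Adj v u → w ∈ S → G.Adj u w → w ≠ v → u ∈ S → G.Adj v w := by
    intro u w hvu hw huw hwv hu
    by_contra hvw
    obtain ⟨T, hT, hT'⟩ := colset w (c s(v, u))
    obtain ⟨x, hx, hxT⟩ := avoid (S.filter (G.Adj w)) (insert u T) (by
      have := hdeg w hw
      have := Finset.card_insert_le u T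
      omega)
    simp only [Finset.mem_filter, Finset.mem_insert, not_or] at hx hxT
    obtain ⟨T1, hT1, hT1'⟩ := colset v (c s(u, w))
    obtain ⟨T2, hT2, hT2'⟩ := colset v (c s(w, x))
    obtain ⟨j, hj, hjT⟩ := avoid (S.filter (G.Adj v)) (insert u (insert x (T1 ∪ T2))) (by
      have := Finset.card_insert_le u (insert x (T1 ∪ T2))
      have := Finset.card_insert_le x (T1 ∪ T2)
      have := Finset.card_union_le T1 T2
      omega)
    simp only [Finset.mem_filter, Finset.mem_insert, Finset.mem_union, not_or] at hj hjT
    obtain ⟨hju, hjx, hj1, hj2⟩ := hjT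
    refine rainbow_of_path_s16 hp hno hj.2.symm hvu huw hx.2 hju ?_ hjx hwv.symm ?_
      (Ne.symm hxT.1) ?_ ?_ ?_
    · rintro rfl; exact hvw hj.2
    · rintro rfl; exact hvw hx.2.symm
    · rw [Sym2.eq_swap]; exact fun h => hj1 (hT1' _ hj.2 h)
    · rw [Sym2.eq_swap]; exact fun h => hj2 (hT2' _ hj.2 h)
    · exact fun h => hxT.2 (hT' _ hx.2 h.symm)
  -- inner neighbours
  have inner : ∀ u, u ∈ S → G.Adj v u → ∀ b, ∃ w ∈ S, G.Adj v w ∧ G.Adj u w ∧ w ≠ b := by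
    intro u hu hvu b
    obtain ⟨w, hw, hwT⟩ := avoid (S.filter (G.Adj u)) {v, b} (by
      have := hdeg u hu
      have := Finset.card_le_two (a := v) (b := b)
      omega)
    simp only [Finset.mem_filter, Finset.mem_insert, Finset.mem_singleton, not_or] at hw hwT
    exact ⟨w, hw.1, closed u w hvu hw.1 hw.2 hwT.1 hu, hw.2, hwT.2⟩
  -- disjoint inner edges have the same colour
  have same : ∀ i w y z, G.Adj v i → G.Adj v w → G.Adj v y → G.Adj v z → G.Adj i w →
      G.Adj y z → i ≠ y → i ≠ z → w ≠ y → w ≠ z → c s(i, w) = c s(y, z) := by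
    intro i w y z hi hw hy hz hiw hyz niy niz nwy nwz
    by_contra hne
    have key : ∀ i w y z, G.Adj v i → G.Adj v w → G.Adj v y → G.Adj v z → G.Adj i w →
        G.Adj y z → i ≠ y → i ≠ z → w ≠ y → w ≠ z → c s(i, w) ≠ c s(y, z) →
        c s(i, w) = c s(v, y) ∨ c s(v, w) = c s(y, z) := by
      intro i w y z hi hw hy hz hiw hyz niy niz nwy nwz hne
      by_contra! h
      refine rainbow_of_path_s16 hp hno hiw hw.symm hy hyz hi.ne.symm niy niz nwy nwz hz.ne
        h.1 hne ?_
      rw [Sym2.eq_swap]; exact h.2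
    have k1 := key i w y z hi hw hy hz hiw hyz niy niz nwy nwz hne
    have k2 := key i w z y hi hw hz hy hiw hyz.symm niz niy nwz nwy (by rwa [Sym2.eq_swap (a := z)])
    have k3 := key w i y z hw hi hy hz hiw.symm hyz nwy nwz niy niz (by rwa [Sym2.eq_swap (a := w)])
    have k4 := key w i z y hw hi hz hy hiw.symm hyz.symm nwz nwy niz niy
      (by rwa [Sym2.eq_swap (a := z), Sym2.eq_swap (a := w)])
    rw [Sym2.eq_swap (a := z)] at k2 k4
    rw [Sym2.eq_swap (a := w)] at k3 k4
    have d1 := hp v i w hi hw hiw.ne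
    have d2 := hp v y z hy hz hyz.ne
    grind
  have noPK : ∀ a b d y z, G.Adj v a → G.Adj v b → G.Adj v d → G.Adj v y → G.Adj v z →
      G.Adj a b → G.Adj b d → G.Adj y z → a ≠ d → a ≠ y → a ≠ z → b ≠ y → b ≠ z → d ≠ y →
      d ≠ z → False := by
    intro a b d y z ha hb hd hy hz hab hbd hyz nad nay naz nby nbz ndy ndz
    have e1 := same a b y z ha hb hy hz hab hyz nay naz nby nbz
    have e2 := same b d y z hb hd hy hz hbd hyz nby nbz ndy ndz
    refine hp b a d hab.symm hbd nad ?_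
    rw [Sym2.eq_swap, e1, e2]
  obtain ⟨w, hw, -⟩ := avoid (S.filter (G.Adj v)) ∅ (by rw [Finset.card_empty]; omega)
  obtain ⟨hwS, hw⟩ := Finset.mem_filter.1 hw
  obtain ⟨i, hiS, hi, hwi, -⟩ := inner w hwS hw w
  obtain ⟨x, hxS, hx, hwx, hxi⟩ := inner w hwS hw i
  obtain ⟨y, hy, hyT⟩ := avoid (S.filter (G.Adj v)) {w, i, x} (by
    have := Finset.card_le_three (a := w) (b := i) (c := x); omega)
  obtain ⟨z, hz, hzT⟩ := avoid (S.filter (G.Adj v)) {w, i, x, y} (by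
    have := Finset.card_le_four (a := w) (b := i) (c := x) (d := y); omega)
  simp only [Finset.mem_filter, Finset.mem_insert, Finset.mem_singleton, not_or] at hy hyT hz hzT
  obtain ⟨hyS, hy⟩ := hy
  obtain ⟨hzS, hz⟩ := hz
  have nwi := hwi.ne
  have nwx := hwx.ne
  have adjs : ∀ y, y ∈ S → G.Adj v y → y ≠ w → y ≠ i → y ≠ x →
      ∀ t, G.Adj v t → G.Adj y t → t = i ∨ t = w ∨ t = x := by
    intro y hyS hy h1 h2 h3 t ht hyt
    by_contra! h
    exact noPK i w x y t hi hw hx hy ht hwi.symm hwx hyt hxi.symm h2.symm h.1.symm h1.symm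
      h.2.1.symm h3.symm h.2.2.symm
  have two : ∀ y, y ∈ S → G.Adj v y → y ≠ w → y ≠ i → y ≠ x →
      (G.Adj y i ∧ G.Adj y w) ∨ (G.Adj y i ∧ G.Adj y x) ∨ (G.Adj y w ∧ G.Adj y x) := by
    intro y hyS hy h1 h2 h3
    obtain ⟨t, -, ht, hyt, -⟩ := inner y hyS hy y
    obtain ⟨tt, -, ht', hyt', hne⟩ := inner y hyS hy t
    rcases adjs y hyS hy h1 h2 h3 t ht hyt with rfl | rfl | rfl <;>
    rcases adjs y hyS hy h1 h2 h3 tt ht' hyt' with rfl | rfl | rfl <;>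
    first
    | exact absurd rfl hne
    | exact Or.inl ⟨hyt, hyt'⟩
    | exact Or.inl ⟨hyt', hyt⟩
    | exact Or.inr (Or.inl ⟨hyt, hyt'⟩)
    | exact Or.inr (Or.inl ⟨hyt', hyt⟩)
    | exact Or.inr (Or.inr ⟨hyt, hyt'⟩)
    | exact Or.inr (Or.inr ⟨hyt', hyt⟩)
  obtain ⟨nyw, nyi, nyx⟩ : y ≠ w ∧ y ≠ i ∧ y ≠ x := hyT
  obtain ⟨nzw, nzi, nzx, nzy⟩ : z ≠ w ∧ z ≠ i ∧ z ≠ x ∧ z ≠ y := hzT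
  have f1 : G.Adj y i → G.Adj z x → False := fun h hh =>
    noPK y i w z x hy hi hw hz hx h hwi.symm hh nyw nzy.symm nyx nzi.symm hxi.symm nzw.symm nwx
  have f2 : G.Adj y x → G.Adj z i → False := fun h hh =>
    noPK y x w z i hy hx hw hz hi h hwx.symm hh nyw nzy.symm nyi nzx.symm hxi nzw.symm nwi
  have f3 : G.Adj y i → G.Adj z i → False := fun h hh =>
    noPK y i z w x hy hi hz hw hx h hh.symm hwx nzy.symm nyw nyx nwi.symm hxi.symm nzw nzx
  have f4 : G.Adj y x → G.Adj z x → False := fun h hh =>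
    noPK y x z w i hy hx hz hw hi h hh.symm hwi nzy.symm nyw nyi nwx.symm hxi nzw nzi
  have t1 := two y hyS hy nyw nyi nyx
  have t2 := two z hzS hz nzw nzi nzx
  tauto

open Classical in
theorem degsum_le {V : Type*} {G : SimpleGraph V} {c : Sym2 V → ℕ}
    (hp : ∀ a b d, G.Adj a b → G.Adj a d → b ≠ d → c s(a, b) ≠ c s(a, d))
    (hno : ¬ HasRainbowCopy (pathGraph 5) G c) (S : Finset V) :
    ∑ v ∈ S, (S.filter (G.Adj v)).card ≤ 4 * S.card := by
  induction S using Finset.strongInduction with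
  | _ S ih =>
  by_cases hdeg : ∀ v ∈ S, 3 ≤ (S.filter (G.Adj v)).card
  · calc _ ≤ ∑ v ∈ S, 4 := Finset.sum_le_sum fun v hv => deg_le_four hp hno S hdeg v hv
      _ = _ := by simp [mul_comm]
  · push Not at hdeg
    obtain ⟨v, hv, hlt⟩ := hdeg
    have h := ih (S.erase v) (Finset.erase_ssubset hv)
    have hc := Finset.card_erase_add_one hv
    rw [← Finset.add_sum_erase S _ hv]
    have h2 : ∑ u ∈ S.erase v, (S.filter (G.Adj u)).card =
        ∑ u ∈ S.erase v, ((S.erase v).filter (G.Adj u)).card +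
          (S.filter (G.Adj v)).card := by
      have e1 : (S.filter (G.Adj v)).card = ∑ u ∈ S.erase v, if G.Adj v u then 1 else 0 := by
        rw [Finset.card_filter, ← Finset.add_sum_erase S _ hv]; simp
      rw [e1, ← Finset.sum_add_distrib]
      refine Finset.sum_congr rfl fun u _ => ?_
      rw [Finset.card_filter, Finset.card_filter, ← Finset.add_sum_erase S _ hv, add_comm,
        G.adj_comm v u]
    omega

theorem upper {n m : ℕ} (hm : m ∈ rainbowExSet n (pathGraph 5)) : m ≤ 2 * n := by
  classical
  obtain ⟨G, c, hp, hno, rfl⟩ := hm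
  have hp' : ∀ a b d, G.Adj a b → G.Adj a d → b ≠ d → c s(a, b) ≠ c s(a, d) := by
    intro a b d hab had hbd
    refine hp (by simpa using hab) (by simpa using had) ?_ ⟨a, by simp, by simp⟩
    intro h
    exact hbd (Sym2.congr_right.1 h)
  have h := degsum_le hp' hno Finset.univ
  have h2 := G.sum_degrees_eq_twice_card_edges
  have h3 : ∀ v, (Finset.univ.filter (G.Adj v)).card = G.degree v := fun v => by
    rw [← G.card_neighborFinset_eq_degree, G.neighborFinset_eq_filter]
  rw [← G.coe_edgeFinset, Set.ncard_coe_finset]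
  simp only [h3, Finset.card_univ, Fintype.card_fin] at h
  omega

/-- Disjoint copies of `K_{4,4}` on the first `8 * (n / 8)` vertices. -/
def blockGraph (n : ℕ) : SimpleGraph (Fin n) where
  Adj a b := a.1 / 8 = b.1 / 8 ∧ a.1 % 2 ≠ b.1 % 2 ∧ a.1 < 8 * (n / 8)
  symm := ⟨fun a b h => by omega⟩
  loopless := ⟨fun a h => h.2.1 rfl⟩

/-- Colour of an edge: the bitwise sum of the positions of its ends in their block. -/
def blockColor (n : ℕ) : Sym2 (Fin n) → ℕ :=
  Sym2.lift ⟨fun a b => (a.1 % 8) ^^^ (b.1 % 8), fun _ _ => Nat.xor_comm _ _⟩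

theorem xor_odd : ∀ a < 8, ∀ b < 8, a % 2 ≠ b % 2 → (a ^^^ b) < 8 ∧ (a ^^^ b) % 2 = 1 := by
  decide

set_option synthInstance.maxSize 2000 in
set_option synthInstance.maxHeartbeats 400000 in
set_option maxRecDepth 10000 in
theorem xor_four : ∀ p < 8, ∀ q < 8, p % 2 = 1 → q % 2 = 1 → p ≠ q → ∀ r < 8, r % 2 = 1 →
    p ≠ r → q ≠ r → ∀ s < 8, s % 2 = 1 → p ≠ s → q ≠ s → r ≠ s →
    p ^^^ (q ^^^ (r ^^^ s)) = 0 := by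
  have key : ∀ p q r s : Fin 4, p ≠ q → p ≠ r → q ≠ r → p ≠ s → q ≠ s → r ≠ s →
      (2 * p.1 + 1) ^^^ ((2 * q.1 + 1) ^^^ ((2 * r.1 + 1) ^^^ (2 * s.1 + 1))) = 0 := by
    decide
  intro p hp q hq op oq pq r hr or pr qr s hs os ps qs rs
  have h := key ⟨p / 2, by omega⟩ ⟨q / 2, by omega⟩ ⟨r / 2, by omega⟩ ⟨s / 2, by omega⟩
  simp only [ne_eq, Fin.mk.injEq] at h
  have e : ∀ p, p % 2 = 1 → 2 * (p / 2) + 1 = p := fun p hp => by omega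
  rw [e p op, e q oq, e r or, e s os] at h
  apply h <;> omega

theorem lower (n : ℕ) : ∃ m ∈ rainbowExSet n (pathGraph 5), 16 * (n / 8) ≤ m := by
  classical
  refine ⟨_, ⟨blockGraph n, blockColor n, ?_, ?_, rfl⟩, ?_⟩
  · rintro e₁ e₂ h1 h2 hne ⟨v, hv1, hv2⟩ hc
    obtain ⟨a, rfl⟩ := hv1
    obtain ⟨b, rfl⟩ := hv2
    rw [mem_edgeSet] at h1 h2
    have hc' : (v.1 % 8) ^^^ (a.1 % 8) = (v.1 % 8) ^^^ (b.1 % 8) := hc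
    have := Nat.xor_right_injective hc'
    have hab : a = b := by
      have := h1.1
      have := h2.1
      ext; omega
    exact hne (by rw [hab])
  · rintro ⟨f, hf, hr⟩
    have adj : ∀ i j : Fin 5, i.1 + 1 = j.1 → (pathGraph 5).Adj i j := fun i j h => by
      rw [pathGraph_adj]; exact Or.inl h
    have a1 := adj 0 1 rfl
    have a2 := adj 1 2 rfl
    have a3 := adj 2 3 rfl
    have a4 := adj 3 4 rfl
    have ne : ∀ i j k l : Fin 5, (pathGraph 5).Adj i j → (pathGraph 5).Adj k l →
        s(i, j) ≠ s(k, l) →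
        ((f i).1 % 8) ^^^ ((f j).1 % 8) ≠ ((f k).1 % 8) ^^^ ((f l).1 % 8) :=
      fun i j k l h hh hn he => hn (hr _ h _ hh he)
    have b1 := hf a1
    have b2 := hf a2
    have b3 := hf a3
    have b4 := hf a4
    have od : ∀ i j : Fin 5, (blockGraph n).Adj (f i) (f j) →
        ((f i).1 % 8) ^^^ ((f j).1 % 8) < 8 ∧ (((f i).1 % 8) ^^^ ((f j).1 % 8)) % 2 = 1 := by
      intro i j h
      have := h.2.1
      exact xor_odd _ (by omega) _ (by omega) (by omega)
    have h0 := xor_four _ (od _ _ b1).1 _ (od _ _ b2).1 (od _ _ b1).2 (od _ _ b2).2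
      (ne _ _ _ _ a1 a2 (by decide)) _ (od _ _ b3).1 (od _ _ b3).2
      (ne _ _ _ _ a1 a3 (by decide)) (ne _ _ _ _ a2 a3 (by decide)) _ (od _ _ b4).1
      (od _ _ b4).2 (ne _ _ _ _ a1 a4 (by decide)) (ne _ _ _ _ a2 a4 (by decide))
      (ne _ _ _ _ a3 a4 (by decide))
    simp only [Nat.xor_assoc, Nat.xor_xor_cancel_left] at h0
    have h04 : (f 0).1 % 8 = (f 4).1 % 8 := Nat.xor_eq_zero_iff.1 h0
    have : f 0 = f 4 := by
      have := b1.1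
      have := b2.1
      have := b3.1
      have := b4.1
      ext; omega
    exact absurd (f.injective this) (by decide)
  · rw [← (blockGraph n).coe_edgeFinset, Set.ncard_coe_finset]
    have h2 := (blockGraph n).sum_degrees_eq_twice_card_edges
    have hd : ∀ v : Fin n, v.1 < 8 * (n / 8) → 4 ≤ (blockGraph n).degree v := by
      intro v hv
      rw [← card_neighborFinset_eq_degree]
      have hb : ∀ s : Fin 4, 8 * (v.1 / 8) + (2 * s.1 + (v.1 + 1) % 2) < n := by
        intro s; omega
      have := Finset.card_le_card_of_injOn (s := (Finset.univ : Finset (Fin 4)))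
        (t := (blockGraph n).neighborFinset v) (fun s => ⟨_, hb s⟩) (by
          intro s _
          simp only [Finset.mem_coe, mem_neighborFinset]
          refine ⟨?_, ?_, hv⟩ <;> dsimp only <;> omega) (by
          intro s _ t _ h
          simp only [Fin.mk.injEq] at h
          ext; omega)
      simpa using this
    have h3 : ∑ v : Fin n, (if v.1 < 8 * (n / 8) then 4 else 0) ≤
        ∑ v, (blockGraph n).degree v := by
      refine Finset.sum_le_sum fun v _ => ?_
      split_ifs with h
      · exact hd v h
      · exact Nat.zero_le _
    have h4 : ∑ v : Fin n, (if v.1 < 8 * (n / 8) then 4 else 0) = 4 * (8 * (n / 8)) := by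
      rw [← Finset.sum_filter, Finset.sum_const, Fin.card_filter_val_lt, smul_eq_mul, mul_comm]
      congr 1
      omega
    omega

/-- If `8 ∣ n` then `ex*(n, P_4) = 2n` (achieved by `n/8` disjoint suitably properly
edge-colored copies of `K_{4,4}`), and in general `ex*(n, P_4) = 2n + O(1)`. -/
theorem rainbowTuran_P4 :
    (∀ n : ℕ, 8 ∣ n → IsGreatest (rainbowExSet n (pathGraph 5)) (2 * n)) ∧
    ∃ C : ℕ, ∀ n : ℕ,
      (∀ m ∈ rainbowExSet n (pathGraph 5), m ≤ 2 * n + C) ∧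
      ∃ m ∈ rainbowExSet n (pathGraph 5), 2 * n ≤ m + C := by
  have hlow : ∀ n : ℕ, ∃ m ∈ rainbowExSet n (pathGraph 5), 16 * (n / 8) ≤ m := lower
  refine ⟨fun n hn => ⟨?_, fun m hm => upper hm⟩, 14, fun n => ⟨fun m hm => ?_, ?_⟩⟩
  · obtain ⟨m, hm, h⟩ := hlow n
    have := upper hm
    have e : m = 2 * n := by omega
    rwa [← e]
  · have := upper hm
    omega
  · obtain ⟨m, hm, h⟩ := hlow n
    exact ⟨m, hm, by omega⟩
end
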